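/- arXiv:1805.11153 — 3 statements merged into one kernel-verified Lean document; each statement's English description precedes it below -/
import Mathlib

section
/- Fix k ≥ 3 and let n > 2k. Then the probability P_k^t(n,1/2) that a random Turán k-partite graph on n vertices with edge probability 1/2 has diameter at most 2 satisfies P_k^t(n,1/2) ≥ 1 − (4n²(3/4)^{n(1−1/k)}/(6k)) · (1 + (k−1)(4/3)^{n/k+1}) · (1 + k/n). -/
open scoped Classical

/-- The number of unordered pairs of vertices lying in two different partite sets, for a
`k`-partite vertex set with part sizes `sz 0, …, sz (k-1)`. -/
def crossPairs (k : ℕ) (sz : Fin k → ℕ) : ℕ :=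
  ∑ i : Fin k, ∑ j : Fin k, if i < j then sz i * sz j else 0

/-- The probability that a random `k`-partite graph — with partite sets of sizes
`sz 0, …, sz (k-1)`, in which each pair of vertices lying in two different partite sets
is joined by an edge independently with probability `p` — is connected with diameter at
most `2`. -/
noncomputable def kpartiteDiam2Prob (k : ℕ) (sz : Fin k → ℕ) (p : ℝ) : ℝ :=
  ∑ G : SimpleGraph (Σ i : Fin k, Fin (sz i)),
    if (∀ u v : (Σ i : Fin k, Fin (sz i)), G.Adj u v → u.1 ≠ v.1) ∧
        G.Connected ∧ ∀ u v : (Σ i : Fin k, Fin (sz i)), G.dist u v ≤ 2 then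
      p ^ Nat.card G.edgeSet * (1 - p) ^ (crossPairs k sz - Nat.card G.edgeSet)
    else 0

/-- The Turán partition of `n` vertices into `k` parts: the part sizes are as equal as
possible, each being `⌊n/k⌋` or `⌈n/k⌉`. -/
def turanSizes (k n : ℕ) : Fin k → ℕ :=
  fun i => if (i : ℕ) < n % k then n / k + 1 else n / k

/-- The probability that a random Turán `k`-partite graph on `n` vertices with edge
probability `p` is connected with diameter at most `2`. -/
noncomputable def turanKpartiteDiam2Prob (k n : ℕ) (p : ℝ) : ℝ :=
  kpartiteDiam2Prob k (turanSizes k n) p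

/-- Among the subsets of `F`, those containing no pair `{f w, g w}`, `w ∈ t`, of a disjoint family
of pairs have proportion at most `(3/4) ^ #t`. -/
lemma four_pow_mul_card_filter_powerset_le {α β : Type*} (F : Finset α) (t : Finset β)
    (f g : β → α) (hf : f.Injective) (hg : g.Injective)
    (hfg : ∀ x ∈ t, ∀ y ∈ t, f x ≠ g y) (hfF : ∀ x ∈ t, f x ∈ F) (hgF : ∀ x ∈ t, g x ∈ F) :
    4 ^ t.card * (F.powerset.filter fun S => ∀ w ∈ t, ¬ (f w ∈ S ∧ g w ∈ S)).card ≤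
      3 ^ t.card * 2 ^ F.card := by
  induction t using Finset.induction_on with
  | empty => simp
  | insert a t ha ih =>
    have ih := ih (fun x hx y hy => hfg x (Finset.mem_insert_of_mem hx) y
      (Finset.mem_insert_of_mem hy)) (fun x hx => hfF x (Finset.mem_insert_of_mem hx))
      (fun x hx => hgF x (Finset.mem_insert_of_mem hx))
    set X := F.powerset.filter fun S => ∀ w ∈ t, ¬ (f w ∈ S ∧ g w ∈ S) with hX
    have hsplit : (F.powerset.filter fun S => ∀ w ∈ insert a t, ¬ (f w ∈ S ∧ g w ∈ S)) =
        X.filter fun S => ¬ (f a ∈ S ∧ g a ∈ S) := by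
      ext S
      simp only [hX, Finset.mem_filter, Finset.forall_mem_insert]
      tauto
    have hfa : f a ∈ F := hfF a (Finset.mem_insert_self _ _)
    have hga : g a ∈ F := hgF a (Finset.mem_insert_self _ _)
    have hne : f a ≠ g a := hfg a (Finset.mem_insert_self _ _) a (Finset.mem_insert_self _ _)
    have hclass : ∀ p q : Prop, (X.filter fun S => (f a ∈ S ↔ p) ∧ (g a ∈ S ↔ q)).card ≤
        (X.filter fun S => f a ∈ S ∧ g a ∈ S).card := by
      intro p q
      refine Finset.card_le_card_of_injOn (fun S => insert (f a) (insert (g a) S)) ?_ ?_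
      · intro S hS
        simp only [hX, Finset.coe_filter, Finset.mem_filter, Finset.mem_powerset,
          Set.mem_ofPred_eq] at hS ⊢
        obtain ⟨⟨hSF, hS⟩, -⟩ := hS
        refine ⟨⟨?_, fun w hw => ?_⟩, by simp, by simp⟩
        · exact Finset.insert_subset hfa (Finset.insert_subset hga hSF)
        · have hwa : w ≠ a := fun h => ha (h ▸ hw)
          have h1 : f w ≠ f a := fun h => hwa (hf h)
          have h2 : g w ≠ g a := fun h => hwa (hg h)
          have h3 : f w ≠ g a :=
            hfg w (Finset.mem_insert_of_mem hw) a (Finset.mem_insert_self _ _)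
          have h4 : g w ≠ f a := fun h =>
            hfg a (Finset.mem_insert_self _ _) w (Finset.mem_insert_of_mem hw) h.symm
          simpa [h1, h2, h3, h4] using hS w hw
      · intro S hS T hT hST
        simp only [Finset.coe_filter, Set.mem_ofPred_eq] at hS hT
        ext x
        by_cases hx : x = f a
        · rw [hx, hS.2.1, hT.2.1]
        · by_cases hx' : x = g a
          · rw [hx', hS.2.2, hT.2.2]
          · have := congrArg (x ∈ ·) hST
            simpa [hx, hx'] using this
    have hcover : X.filter (fun S => ¬ (f a ∈ S ∧ g a ∈ S)) ⊆
        (X.filter fun S => (f a ∈ S ↔ False) ∧ (g a ∈ S ↔ False)) ∪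
        ((X.filter fun S => (f a ∈ S ↔ True) ∧ (g a ∈ S ↔ False)) ∪
        (X.filter fun S => (f a ∈ S ↔ False) ∧ (g a ∈ S ↔ True))) := by
      intro S
      simp only [Finset.mem_filter, Finset.mem_union]
      tauto
    have h1 := (Finset.card_le_card hcover).trans ((Finset.card_union_le _ _).trans
      (Nat.add_le_add_left (Finset.card_union_le _ _) _))
    have h2 : (X.filter fun S => (f a ∈ S ↔ False) ∧ (g a ∈ S ↔ False)).card ≤
        (X.filter fun S => f a ∈ S ∧ g a ∈ S).card := by
      convert hclass False False
    have h3 : (X.filter fun S => (f a ∈ S ↔ True) ∧ (g a ∈ S ↔ False)).card ≤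
        (X.filter fun S => f a ∈ S ∧ g a ∈ S).card := by
      convert hclass True False
    have h4 : (X.filter fun S => (f a ∈ S ↔ False) ∧ (g a ∈ S ↔ True)).card ≤
        (X.filter fun S => f a ∈ S ∧ g a ∈ S).card := by
      convert hclass False True
    have h5 := Finset.card_filter_add_card_filter_not (s := X) (fun S => f a ∈ S ∧ g a ∈ S)
    rw [hsplit, Finset.card_insert_of_notMem ha]
    have h6 : 4 * (X.filter fun S => ¬ (f a ∈ S ∧ g a ∈ S)).card ≤ 3 * X.card := by omega
    calc _ = 4 ^ t.card * (4 * (X.filter fun S => ¬ (f a ∈ S ∧ g a ∈ S)).card) := by ring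
      _ ≤ 4 ^ t.card * (3 * X.card) := Nat.mul_le_mul_left _ h6
      _ = 3 * (4 ^ t.card * X.card) := by ring
      _ ≤ 3 * (3 ^ t.card * 2 ^ F.card) := Nat.mul_le_mul_left _ ih
      _ = _ := by ring

/-- Subgraphs of `K` with prescribed property correspond to subsets of its edge set. -/
lemma card_filter_le_graph {V : Type*} [Fintype V] (K : SimpleGraph V)
    (P : Finset (Sym2 V) → Prop) :
    (Finset.univ.filter fun G : SimpleGraph V => G ≤ K ∧ P G.edgeFinset).card =
      (K.edgeFinset.powerset.filter P).card := by
  refine Finset.card_bij (fun G _ => G.edgeFinset) ?_ ?_ ?_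
  · intro G hG
    simpa using hG
  · intro G _ H _ h
    exact SimpleGraph.edgeFinset_inj.1 h
  · intro S hS
    simp only [Finset.mem_filter, Finset.mem_powerset] at hS
    have hSK : (S : Set (Sym2 V)) ⊆ K.edgeSet := by
      intro e he
      simpa using hS.1 he
    have hE : ∀ inst : Fintype (SimpleGraph.fromEdgeSet (S : Set (Sym2 V))).edgeSet,
        @SimpleGraph.edgeFinset V (SimpleGraph.fromEdgeSet (S : Set (Sym2 V))) inst = S := by
      intro inst
      ext e
      simp only [SimpleGraph.mem_edgeFinset, SimpleGraph.edgeSet_fromEdgeSet, Set.mem_sdiff,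
        Finset.mem_coe, and_iff_left_iff_imp]
      intro he
      exact K.not_isDiag_of_mem_edgeSet (hSK he)
    refine ⟨SimpleGraph.fromEdgeSet (S : Set (Sym2 V)), ?_, hE _⟩
    simp only [Finset.mem_filter, Finset.mem_univ, true_and]
    refine ⟨?_, by rw [hE]; exact hS.2⟩
    rw [← SimpleGraph.edgeFinset_subset_edgeFinset, hE]
    exact hS.1

lemma card_le_graph {V : Type*} [Fintype V] (K : SimpleGraph V) :
    (Finset.univ.filter fun G : SimpleGraph V => G ≤ K).card = 2 ^ K.edgeFinset.card := by
  simpa using card_filter_le_graph K (fun _ => True)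

/-- The proportion of subgraphs of `K` in which `u` and `v` have no common neighbour in `W`. -/
lemma card_no_common_neighbor_le {V : Type*} [Fintype V] (K : SimpleGraph V) (u v : V)
    (huv : u ≠ v) (W : Finset V) (hu : ∀ w ∈ W, K.Adj u w) (hv : ∀ w ∈ W, K.Adj v w) :
    ((Finset.univ.filter fun G : SimpleGraph V => G ≤ K ∧
        ∀ w ∈ W, ¬ (G.Adj u w ∧ G.Adj v w)).card : ℝ) ≤
      (3 / 4) ^ W.card * 2 ^ K.edgeFinset.card := by
  have h := four_pow_mul_card_filter_powerset_le K.edgeFinset W (fun w => s(u, w))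
    (fun w => s(v, w)) (fun _ _ h => Sym2.congr_right.1 h) (fun _ _ h => Sym2.congr_right.1 h)
    (by
      intro x hx y hy h
      rcases Sym2.eq_iff.1 h with h | h
      · exact huv h.1
      · exact (hu y hy).ne h.1)
    (fun w hw => by simpa using hu w hw) (fun w hw => by simpa using hv w hw)
  have hcard := card_filter_le_graph K (fun S => ∀ w ∈ W, ¬ (s(u, w) ∈ S ∧ s(v, w) ∈ S))
  have hS : (K.edgeFinset.powerset.filter
      (fun S => ∀ w ∈ W, ¬ (s(u, w) ∈ S ∧ s(v, w) ∈ S))).card =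
      (Finset.univ.filter fun G : SimpleGraph V => G ≤ K ∧
        ∀ w ∈ W, ¬ (G.Adj u w ∧ G.Adj v w)).card := by
    convert hcard.symm using 4
    simp
  replace h : 4 ^ W.card * (K.edgeFinset.powerset.filter
      (fun S => ∀ w ∈ W, ¬ (s(u, w) ∈ S ∧ s(v, w) ∈ S))).card ≤
      3 ^ W.card * 2 ^ K.edgeFinset.card := by
    convert h
  rw [hS] at h
  rw [div_pow, div_mul_eq_mul_div, le_div_iff₀ (by positivity), mul_comm]
  exact_mod_cast h

/-- The proportion of subgraphs of `K` in which the `K`-adjacent vertices `u` and `v` are not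
adjacent and have no common neighbour in `W`. -/
lemma card_not_adj_no_common_neighbor_le {V : Type*} [Fintype V] (K : SimpleGraph V) (u v : V)
    (huv : K.Adj u v) (W : Finset V) (hu : ∀ w ∈ W, K.Adj u w) (hv : ∀ w ∈ W, K.Adj v w) :
    ((Finset.univ.filter fun G : SimpleGraph V => G ≤ K ∧
        (¬ G.Adj u v ∧ ∀ w ∈ W, ¬ (G.Adj u w ∧ G.Adj v w))).card : ℝ) ≤
      1 / 2 * (3 / 4) ^ W.card * 2 ^ K.edgeFinset.card := by
  have he : s(u, v) ∈ K.edgeFinset := by simpa using huv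
  have h := four_pow_mul_card_filter_powerset_le (K.edgeFinset.erase s(u, v)) W
    (fun w => s(u, w))
    (fun w => s(v, w)) (fun _ _ h => Sym2.congr_right.1 h) (fun _ _ h => Sym2.congr_right.1 h)
    (by
      intro x hx y hy h
      rcases Sym2.eq_iff.1 h with h | h
      · exact huv.ne h.1
      · exact (hu y hy).ne h.1)
    (fun w hw => Finset.mem_erase.2 ⟨fun h => (hv w hw).ne (Sym2.congr_right.1 h).symm,
      by simpa using hu w hw⟩)
    (fun w hw => Finset.mem_erase.2 ⟨fun h => (hu w hw).ne
      (Sym2.congr_right.1 (h.trans Sym2.eq_swap)).symm, by simpa using hv w hw⟩)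
  have hcard := card_filter_le_graph K
    (fun S => s(u, v) ∉ S ∧ ∀ w ∈ W, ¬ (s(u, w) ∈ S ∧ s(v, w) ∈ S))
  have hS : ((K.edgeFinset.erase s(u, v)).powerset.filter
      (fun S => ∀ w ∈ W, ¬ (s(u, w) ∈ S ∧ s(v, w) ∈ S))).card =
      (Finset.univ.filter fun G : SimpleGraph V => G ≤ K ∧
        (¬ G.Adj u v ∧ ∀ w ∈ W, ¬ (G.Adj u w ∧ G.Adj v w))).card := by
    trans (K.edgeFinset.powerset.filter
      (fun S => s(u, v) ∉ S ∧ ∀ w ∈ W, ¬ (s(u, w) ∈ S ∧ s(v, w) ∈ S))).card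
    · congr 1
      ext S
      simp only [Finset.mem_filter, Finset.mem_powerset, Finset.subset_erase]
      tauto
    · convert hcard.symm using 4
      simp
  replace h : 4 ^ W.card * ((K.edgeFinset.erase s(u, v)).powerset.filter
      (fun S => ∀ w ∈ W, ¬ (s(u, w) ∈ S ∧ s(v, w) ∈ S))).card ≤
      3 ^ W.card * 2 ^ (K.edgeFinset.erase s(u, v)).card := by
    convert h
  rw [hS] at h
  have hpow : (2 : ℝ) ^ K.edgeFinset.card = 2 * 2 ^ (K.edgeFinset.erase s(u, v)).card := by
    rw [← Finset.card_erase_add_one he, pow_succ, mul_comm]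
  have h' : (1 / 2 : ℝ) * (3 / 4) ^ W.card * 2 ^ K.edgeFinset.card =
      3 ^ W.card * 2 ^ (K.edgeFinset.erase s(u, v)).card / 4 ^ W.card := by
    rw [hpow, div_pow]
    ring
  rw [h', le_div_iff₀ (by positivity), mul_comm]
  exact_mod_cast h

lemma connected_and_dist_le_two {V : Type*} [Nonempty V] (G : SimpleGraph V)
    (h : ∀ u v, u ≠ v → G.Adj u v ∨ ∃ w, G.Adj u w ∧ G.Adj v w) :
    G.Connected ∧ ∀ u v, G.dist u v ≤ 2 := by
  have hw : ∀ u v, ∃ p : G.Walk u v, p.length ≤ 2 := by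
    intro u v
    by_cases huv : u = v
    · subst huv
      exact ⟨.nil, by simp⟩
    · rcases h u v huv with h | ⟨w, h1, h2⟩
      · exact ⟨.cons h .nil, by simp⟩
      · exact ⟨.cons h1 (.cons h2.symm .nil), by simp⟩
  refine ⟨⟨fun u v => ?_⟩, fun u v => ?_⟩
  · exact (hw u v).choose.reachable
  · obtain ⟨p, hp⟩ := hw u v
    exact (SimpleGraph.dist_le p).trans hp

lemma sum_card_filter_ge_two_mul {α β : Type*} [Fintype β] (X : Finset α) (r : β × β → α → Prop)
    (hsymm : ∀ u v a, r (u, v) a → r (v, u) a) (hne : ∀ u v a, r (u, v) a → u ≠ v) :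
    2 * (X.filter fun a => ∃ p, r p a).card ≤ ∑ p, (X.filter fun a => r p a).card := by
  have h := Finset.sum_card_bipartiteAbove_eq_sum_card_bipartiteBelow (s := Finset.univ)
    (t := X) r
  simp only [Finset.bipartiteAbove, Finset.bipartiteBelow] at h
  rw [h, mul_comm, ← smul_eq_mul, ← Finset.sum_const]
  refine (Finset.sum_le_sum fun a ha => ?_).trans
    (Finset.sum_le_sum_of_subset (Finset.filter_subset (fun a => ∃ p, r p a) X))
  obtain ⟨⟨u, v⟩, hp⟩ := (Finset.mem_filter.1 ha).2
  have hpair : ({(u, v), (v, u)} : Finset (β × β)).card = 2 :=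
    Finset.card_pair fun h => hne u v a hp (Prod.ext_iff.1 h).1
  rw [← hpair]
  refine Finset.card_le_card fun p hp' => ?_
  simp only [Finset.mem_insert, Finset.mem_singleton] at hp'
  rcases hp' with rfl | rfl
  · simpa using hp
  · simpa using hsymm u v a hp

lemma card_edgeFinset_completeMultipartiteGraph_eq_crossPairs (k : ℕ) (sz : Fin k → ℕ) :
    (SimpleGraph.completeMultipartiteGraph fun i => Fin (sz i)).edgeFinset.card =
      crossPairs k sz := by
  have h := (SimpleGraph.completeMultipartiteGraph
    fun i => Fin (sz i)).two_mul_card_edgeFinset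
  have h1 : (Finset.univ.filter fun p : (Σ i, Fin (sz i)) × (Σ i, Fin (sz i)) =>
      p.1.1 ≠ p.2.1).card = ∑ i, ∑ j, if i ≠ j then sz i * sz j else 0 := by
    rw [Finset.card_filter, Fintype.sum_prod_type, Fintype.sum_sigma]
    refine Finset.sum_congr rfl fun i _ => ?_
    simp only [Fintype.sum_sigma]
    rw [Finset.sum_comm]
    refine Finset.sum_congr rfl fun j _ => ?_
    split_ifs <;> simp
  have h2 : ∑ i, ∑ j, (if i ≠ j then sz i * sz j else 0) = 2 * crossPairs k sz := by
    have h3 : crossPairs k sz = ∑ i : Fin k, ∑ j : Fin k, if j < i then sz i * sz j else 0 := by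
      rw [crossPairs, Finset.sum_comm]
      simp only [mul_comm]
    rw [two_mul]
    nth_rewrite 2 [h3]
    rw [crossPairs, ← Finset.sum_add_distrib]
    refine Finset.sum_congr rfl fun i _ => ?_
    rw [← Finset.sum_add_distrib]
    refine Finset.sum_congr rfl fun j _ => ?_
    rcases lt_trichotomy i j with h | h | h
    · simp [h, h.ne, h.le]
    · simp [h]
    · simp [h, h.ne', h.le]
  have h4 : 2 * (SimpleGraph.completeMultipartiteGraph fun i => Fin (sz i)).edgeFinset.card =
      2 * crossPairs k sz := by
    rw [← h2, ← h1]
    convert h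
  omega

lemma kpartiteDiam2Prob_half_eq (k : ℕ) (sz : Fin k → ℕ) :
    kpartiteDiam2Prob k sz (1 / 2) =
      (Finset.univ.filter fun G : SimpleGraph (Σ i : Fin k, Fin (sz i)) =>
        G ≤ (SimpleGraph.completeMultipartiteGraph fun i => Fin (sz i)) ∧
        G.Connected ∧ ∀ u v, G.dist u v ≤ 2).card / 2 ^ crossPairs k sz := by
  rw [kpartiteDiam2Prob, div_eq_mul_inv (b := 2 ^ crossPairs k sz), ← nsmul_eq_mul, ← Finset.sum_const,
    Finset.sum_filter]
  refine Finset.sum_congr rfl fun G _ => ?_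
  have hiff : (∀ u v : (Σ i : Fin k, Fin (sz i)), G.Adj u v → u.1 ≠ v.1) ↔
      G ≤ SimpleGraph.completeMultipartiteGraph fun i => Fin (sz i) := by
    rw [SimpleGraph.le_iff_adj]
    rfl
  simp only [hiff]
  split_ifs with h
  · have hle : Nat.card G.edgeSet ≤ crossPairs k sz := by
      rw [← card_edgeFinset_completeMultipartiteGraph_eq_crossPairs, Nat.card_eq_fintype_card,
        ← SimpleGraph.edgeFinset_card]
      exact Finset.card_le_card (SimpleGraph.edgeFinset_subset_edgeFinset.2 h.1)
    norm_num only
    rw [← pow_add, Nat.add_sub_cancel' hle, div_pow, one_pow, one_div]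
  · rfl

/-- The union bound over pairs of vertices that are neither adjacent nor have a common
neighbour. -/
lemma card_subgraphs_diam_le_two_ge {V : Type*} [Fintype V] [Nonempty V] (K : SimpleGraph V) :
    (1 - 1 / 2 * ∑ p : V × V, (if p.1 = p.2 then 0 else (if K.Adj p.1 p.2 then 1 / 2 else 1) *
        (3 / 4 : ℝ) ^ (Finset.univ.filter fun w => K.Adj p.1 w ∧ K.Adj p.2 w).card)) *
        2 ^ K.edgeFinset.card ≤
      (Finset.univ.filter fun G : SimpleGraph V =>
        G ≤ K ∧ G.Connected ∧ ∀ u v, G.dist u v ≤ 2).card := by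
  let W : V × V → Finset V := fun p =>
    Finset.univ.filter fun w => K.Adj p.1 w ∧ K.Adj p.2 w
  obtain ⟨r, hr⟩ : ∃ r : V × V → SimpleGraph V → Prop, ∀ p G, r p G ↔ p.1 ≠ p.2 ∧
    ¬ G.Adj p.1 p.2 ∧ ∀ w ∈ W p, ¬ (G.Adj p.1 w ∧ G.Adj p.2 w) := ⟨_, fun _ _ => Iff.rfl⟩
  let X := Finset.univ.filter fun G : SimpleGraph V => G ≤ K
  have hX : X.card = 2 ^ K.edgeFinset.card := card_le_graph K
  have hsum := sum_card_filter_ge_two_mul X r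
    (fun u v G h => by
      rw [hr] at h ⊢
      exact ⟨h.1.symm, fun h' => h.2.1 h'.symm, fun w hw h' => h.2.2 w
        (by simpa [W, and_comm] using hw) h'.symm⟩) (fun u v G h => ((hr _ _).1 h).1)
  have hcover : X ⊆ (Finset.univ.filter fun G : SimpleGraph V =>
      G ≤ K ∧ G.Connected ∧ ∀ u v, G.dist u v ≤ 2) ∪ X.filter fun G => ∃ p, r p G := by
    intro G hG
    have hGK : G ≤ K := (Finset.mem_filter.1 hG).2
    by_cases hex : ∃ p, r p G
    · exact Finset.mem_union_right _ (Finset.mem_filter.2 ⟨hG, hex⟩)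
    · refine Finset.mem_union_left _ (Finset.mem_filter.2 ⟨Finset.mem_univ _, hGK, ?_⟩)
      refine connected_and_dist_le_two G fun u v huv => ?_
      by_contra! hcon
      exact hex ⟨(u, v), (hr _ _).2 ⟨huv, hcon.1, fun w _ hw => hcon.2 w hw.1 hw.2⟩⟩
  have hcard := (Finset.card_le_card hcover).trans (Finset.card_union_le _ _)
  have hterm : ∀ p : V × V, ((X.filter fun G => r p G).card : ℝ) ≤
      (if p.1 = p.2 then 0 else (if K.Adj p.1 p.2 then 1 / 2 else 1) *
        (3 / 4) ^ (W p).card) * 2 ^ K.edgeFinset.card := by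
    rintro ⟨u, v⟩
    have hu : ∀ w ∈ W (u, v), K.Adj u w := fun w hw => (Finset.mem_filter.1 hw).2.1
    have hv : ∀ w ∈ W (u, v), K.Adj v w := fun w hw => (Finset.mem_filter.1 hw).2.2
    by_cases huv : u = v
    · have : (X.filter fun G => r (u, v) G) = ∅ :=
        Finset.filter_eq_empty_iff.2 fun G _ h => ((hr _ _).1 h).1 huv
      rw [this]
      simp [huv]
    · simp only [huv, if_false]
      by_cases hi : K.Adj u v
      · simp only [hi, if_true]
        refine le_trans ?_ (card_not_adj_no_common_neighbor_le K u v hi (W (u, v)) hu hv)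
        refine Nat.cast_le.2 (Finset.card_le_card fun G hG => ?_)
        simp only [Finset.mem_filter, X, hr] at hG ⊢
        exact ⟨Finset.mem_univ _, hG.1.2, hG.2.2⟩
      · simp only [hi, if_false, one_mul]
        refine le_trans ?_ (card_no_common_neighbor_le K u v huv (W (u, v)) hu hv)
        refine Nat.cast_le.2 (Finset.card_le_card fun G hG => ?_)
        simp only [Finset.mem_filter, X, hr] at hG ⊢
        exact ⟨Finset.mem_univ _, hG.1.2, hG.2.2.2⟩
  have hsum' : (2 : ℝ) * (X.filter fun G => ∃ p, r p G).card ≤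
      ∑ p, ((X.filter fun G => r p G).card : ℝ) := by
    exact_mod_cast hsum
  have htot := hsum'.trans (Finset.sum_le_sum fun p _ => hterm p)
  rw [← Finset.sum_mul] at htot
  have hcard' : (2 : ℝ) ^ K.edgeFinset.card ≤
      (Finset.univ.filter fun G : SimpleGraph V =>
        G ≤ K ∧ G.Connected ∧ ∀ u v, G.dist u v ≤ 2).card +
      (X.filter fun G => ∃ p, r p G).card := by
    rw [hX] at hcard
    exact_mod_cast hcard
  linarith

lemma one_sub_le_kpartiteDiam2Prob_half (k : ℕ) (sz : Fin k → ℕ)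
    [Nonempty (Σ i : Fin k, Fin (sz i))] :
    1 - 1 / 2 * ∑ p : (Σ i : Fin k, Fin (sz i)) × (Σ i : Fin k, Fin (sz i)),
      (if p.1 = p.2 then 0 else (if p.1.1 ≠ p.2.1 then 1 / 2 else 1) *
        (3 / 4 : ℝ) ^ (Finset.univ.filter fun w : (Σ i : Fin k, Fin (sz i)) =>
          p.1.1 ≠ w.1 ∧ p.2.1 ≠ w.1).card) ≤
      kpartiteDiam2Prob k sz (1 / 2) := by
  rw [kpartiteDiam2Prob_half_eq, le_div_iff₀ (by positivity),
    ← card_edgeFinset_completeMultipartiteGraph_eq_crossPairs]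
  convert card_subgraphs_diam_le_two_ge
    (SimpleGraph.completeMultipartiteGraph fun i => Fin (sz i))
  rfl

lemma turanSizes_le (k n : ℕ) (i : Fin k) : (turanSizes k n i : ℝ) ≤ n / k + 1 := by
  have h : turanSizes k n i ≤ n / k + 1 := by
    unfold turanSizes
    split_ifs <;> omega
  have h1 : ((n / k : ℕ) : ℝ) ≤ n / k := Nat.cast_div_le
  have h2 : (turanSizes k n i : ℝ) ≤ (n / k : ℕ) + 1 := by exact_mod_cast h
  linarith

lemma sum_turanSizes (k n : ℕ) (hk : 0 < k) : ∑ i, turanSizes k n i = n := by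
  have h : ∀ i, turanSizes k n i = n / k + if (i : ℕ) < n % k then 1 else 0 := by
    intro i
    unfold turanSizes
    split_ifs <;> rfl
  simp only [h, Finset.sum_add_distrib, Finset.sum_const, Finset.card_univ, Fintype.card_fin,
    smul_eq_mul]
  rw [← Finset.card_filter, Fin.card_filter_val_lt, min_eq_right (Nat.mod_lt n hk).le]
  exact Nat.div_add_mod n k

lemma card_filter_fst_eq {k : ℕ} (sz : Fin k → ℕ) (i : Fin k) :
    (Finset.univ.filter fun w : (Σ i : Fin k, Fin (sz i)) => i = w.1).card = sz i := by
  rw [Finset.card_filter, Fintype.sum_sigma]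
  have h : ∀ x : Fin k, (∑ _y : Fin (sz x), if i = x then 1 else 0) =
      if i = x then sz x else 0 := by
    intro x
    split_ifs <;> simp
  simp only [h, Finset.sum_ite_eq, Finset.mem_univ, if_true]

lemma card_sigma_turanSizes (k n : ℕ) (hk : 0 < k) :
    Fintype.card (Σ i : Fin k, Fin (turanSizes k n i)) = n := by
  simp [sum_turanSizes k n hk]

/-- A lower bound for the number of vertices outside the parts `i` and `j`. -/
lemma card_sub_le_card_filter_ne {k : ℕ} (sz : Fin k → ℕ) (i j : Fin k) :
    (Fintype.card (Σ i : Fin k, Fin (sz i)) : ℝ) - (sz i + if i ≠ j then (sz j : ℝ) else 0) ≤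
      (Finset.univ.filter fun w : (Σ i : Fin k, Fin (sz i)) => i ≠ w.1 ∧ j ≠ w.1).card := by
  have hcover : (Finset.univ : Finset (Σ i : Fin k, Fin (sz i))) ⊆
      (Finset.univ.filter fun w : (Σ i : Fin k, Fin (sz i)) => i ≠ w.1 ∧ j ≠ w.1) ∪
      ((Finset.univ.filter fun w : (Σ i : Fin k, Fin (sz i)) => i = w.1) ∪
      (Finset.univ.filter fun w : (Σ i : Fin k, Fin (sz i)) => i ≠ j ∧ j = w.1)) := by
    intro w _
    simp only [Finset.mem_union, Finset.mem_filter, Finset.mem_univ, true_and]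
    grind
  have h := (Finset.card_le_card hcover).trans ((Finset.card_union_le _ _).trans
    (Nat.add_le_add_left (Finset.card_union_le _ _) _))
  rw [card_filter_fst_eq, Finset.card_univ] at h
  by_cases hij : i = j
  · simp only [hij, ne_eq, not_true_eq_false, false_and, Finset.filter_false, Finset.card_empty,
      add_zero, if_false] at h ⊢
    rw [sub_le_iff_le_add]
    exact_mod_cast h
  · simp only [ne_eq, hij, not_false_eq_true, true_and, if_true] at h ⊢
    rw [card_filter_fst_eq] at h
    rw [sub_le_iff_le_add]
    exact_mod_cast h

/-- The total weight of the pairs of vertices in the union bound. -/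
lemma sum_pairs_turanSizes_le (k n : ℕ) (hk : 0 < k) :
    ∑ p : (Σ i : Fin k, Fin (turanSizes k n i)) × (Σ i : Fin k, Fin (turanSizes k n i)),
      (if p.1 = p.2 then 0 else (if p.1.1 ≠ p.2.1 then 1 / 2 else 1) *
        (3 / 4 : ℝ) ^ (Finset.univ.filter fun w : (Σ i : Fin k, Fin (turanSizes k n i)) =>
          p.1.1 ≠ w.1 ∧ p.2.1 ≠ w.1).card) ≤
      n * (n / k * (4 / 3 * (3 / 4 : ℝ) ^ ((n : ℝ) * (1 - 1 / (k : ℝ)))) +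
        n * (1 / 2 * (4 / 3 * (3 / 4 : ℝ) ^ ((n : ℝ) * (1 - 1 / (k : ℝ))) *
          (4 / 3 : ℝ) ^ ((n : ℝ) / (k : ℝ) + 1)))) := by
  set Y := (3 / 4 : ℝ) ^ ((n : ℝ) * (1 - 1 / (k : ℝ))) with hY
  set Z := (4 / 3 : ℝ) ^ ((n : ℝ) / (k : ℝ) + 1) with hZ
  have hY0 : 0 < Y := by positivity
  have hZ0 : 0 < Z := by positivity
  have hk0 : (k : ℝ) ≠ 0 := by positivity
  have hYeq : (3 / 4 : ℝ) ^ ((n : ℝ) - (n / k + 1)) = 4 / 3 * Y := by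
    rw [show (n : ℝ) - (n / k + 1) = n * (1 - 1 / k) - 1 by field_simp; ring,
      Real.rpow_sub_one (by norm_num), ← hY]
    ring
  have hYZeq : (3 / 4 : ℝ) ^ ((n : ℝ) - (n / k + 1 + (n / k + 1))) = 4 / 3 * Y * Z := by
    rw [← hYeq, hZ, show (4 / 3 : ℝ) = (3 / 4)⁻¹ by norm_num, Real.inv_rpow (by norm_num),
      ← Real.rpow_neg (by norm_num), ← Real.rpow_add (by norm_num)]
    congr 1
    ring
  have hW : ∀ (i j : Fin k) (x : ℝ),
      x ≤ n - (turanSizes k n i + if i ≠ j then (turanSizes k n j : ℝ) else 0) →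
      (3 / 4 : ℝ) ^ (Finset.univ.filter fun w : (Σ i : Fin k, Fin (turanSizes k n i)) =>
          i ≠ w.1 ∧ j ≠ w.1).card ≤ (3 / 4 : ℝ) ^ x := by
    intro i j x hx
    have h := card_sub_le_card_filter_ne (turanSizes k n) i j
    rw [card_sigma_turanSizes k n hk] at h
    rw [← Real.rpow_natCast]
    exact Real.rpow_le_rpow_of_exponent_ge (by norm_num) (by norm_num) (hx.trans h)
  rw [Fintype.sum_prod_type]
  have hinner : ∀ u : (Σ i : Fin k, Fin (turanSizes k n i)),
      ∑ v : (Σ i : Fin k, Fin (turanSizes k n i)),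
      (if u = v then 0 else (if u.1 ≠ v.1 then 1 / 2 else 1) *
        (3 / 4 : ℝ) ^ (Finset.univ.filter fun w : (Σ i : Fin k, Fin (turanSizes k n i)) =>
          u.1 ≠ w.1 ∧ v.1 ≠ w.1).card) ≤
      n / k * (4 / 3 * Y) + n * (1 / 2 * (4 / 3 * Y * Z)) := by
    intro u
    have hpt : ∀ v : (Σ i : Fin k, Fin (turanSizes k n i)),
        (if u = v then 0 else (if u.1 ≠ v.1 then 1 / 2 else 1) *
        (3 / 4 : ℝ) ^ (Finset.univ.filter fun w : (Σ i : Fin k, Fin (turanSizes k n i)) =>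
          u.1 ≠ w.1 ∧ v.1 ≠ w.1).card) ≤
        (if u.1 = v.1 then 4 / 3 * Y else 0) - (if u = v then 4 / 3 * Y else 0) +
          1 / 2 * (4 / 3 * Y * Z) := by
      intro v
      have hu := turanSizes_le k n u.1
      have hv := turanSizes_le k n v.1
      by_cases huv : u = v
      · subst huv
        simp only [if_true, sub_self, zero_add]
        positivity
      · by_cases hi : u.1 = v.1
        · have h := hW u.1 v.1 (n - (n / k + 1)) (by simp [hi] at hu ⊢; linarith)
          rw [hYeq] at h
          simp only [huv, hi, ne_eq, not_true_eq_false, if_true, if_false, one_mul,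
            sub_zero] at h ⊢
          have : 0 ≤ 1 / 2 * (4 / 3 * Y * Z) := by positivity
          linarith
        · have h := hW u.1 v.1 (n - (n / k + 1 + (n / k + 1))) (by simp [hi]; linarith)
          rw [hYZeq] at h
          simp only [huv, hi, ne_eq, not_false_eq_true, if_true, if_false, sub_self,
            zero_add] at h ⊢
          linarith
    refine (Finset.sum_le_sum fun v _ => hpt v).trans ?_
    rw [Finset.sum_add_distrib, Finset.sum_sub_distrib, Finset.sum_const, Finset.card_univ,
      card_sigma_turanSizes k n hk, nsmul_eq_mul, ← Finset.sum_filter, Finset.sum_const,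
      card_filter_fst_eq, nsmul_eq_mul, Finset.sum_ite_eq, if_pos (Finset.mem_univ _)]
    have h := mul_le_mul_of_nonneg_right (turanSizes_le k n u.1)
      (by positivity : 0 ≤ 4 / 3 * Y)
    linarith
  refine (Finset.sum_le_sum fun u _ => hinner u).trans_eq ?_
  rw [Finset.sum_const, Finset.card_univ, card_sigma_turanSizes k n hk, nsmul_eq_mul]

/-- Lower bound for random Turán `k`-partite graphs with edge probability `1/2` having
diameter at most 2. Real powers are used for the real exponents. -/
theorem turanKpartiteDiam2Prob_half (k : ℕ) (hk : 3 ≤ k) (n : ℕ) (hn : 2 * k < n) :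
    1 - (4 * (n : ℝ) ^ 2 * (3 / 4 : ℝ) ^ ((n : ℝ) * (1 - 1 / (k : ℝ))) / (6 * (k : ℝ))) *
        (1 + ((k : ℝ) - 1) * (4 / 3 : ℝ) ^ ((n : ℝ) / (k : ℝ) + 1)) *
        (1 + (k : ℝ) / (n : ℝ)) ≤
      turanKpartiteDiam2Prob k n (1 / 2) := by
  have hk0 : (0 : ℝ) < k := by positivity
  have hn0 : (0 : ℝ) < n := by
    have : 0 < n := by omega
    positivity
  have hne : Nonempty (Σ i : Fin k, Fin (turanSizes k n i)) := by
    rw [← Fintype.card_pos_iff, card_sigma_turanSizes k n (by omega)]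
    omega
  refine le_trans ?_ (one_sub_le_kpartiteDiam2Prob_half k (turanSizes k n))
  have h := sum_pairs_turanSizes_le k n (by omega)
  set Y := (3 / 4 : ℝ) ^ ((n : ℝ) * (1 - 1 / (k : ℝ)))
  set Z := (4 / 3 : ℝ) ^ ((n : ℝ) / (k : ℝ) + 1)
  have hY0 : 0 < Y := by positivity
  have hZ0 : 0 < Z := by positivity
  have hk3 : (3 : ℝ) ≤ k := by exact_mod_cast hk
  have hA : 1 / 2 * (n * (n / k * (4 / 3 * Y) + n * (1 / 2 * (4 / 3 * Y * Z)))) ≤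
      (4 * (n : ℝ) ^ 2 * Y / (6 * (k : ℝ))) * (1 + ((k : ℝ) - 1) * Z) := by
    have hdiff : (4 * (n : ℝ) ^ 2 * Y / (6 * (k : ℝ))) * (1 + ((k : ℝ) - 1) * Z) -
        1 / 2 * (n * (n / k * (4 / 3 * Y) + n * (1 / 2 * (4 / 3 * Y * Z)))) =
        (n : ℝ) ^ 2 * Y * Z * (k - 2) / (3 * k) := by
      field_simp
      ring
    have : 0 ≤ (n : ℝ) ^ 2 * Y * Z * (k - 2) / (3 * k) := by
      have : (0 : ℝ) ≤ k - 2 := by linarith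
      positivity
    linarith
  have hB : 0 ≤ (4 * (n : ℝ) ^ 2 * Y / (6 * (k : ℝ))) * (1 + ((k : ℝ) - 1) * Z) := by
    have : (0 : ℝ) ≤ k - 1 := by linarith
    positivity
  have hC := le_mul_of_one_le_right hB
    (by have : 0 ≤ (k : ℝ) / n := by positivity
        linarith : 1 ≤ 1 + (k : ℝ) / n)
  linarith
end

section
/- Let n₁, n₂ be integers with 2 ≤ n₁ ≤ n₂ and n₁ + n₂ = n ≥ 4. Then for every p ∈ [0,1], the probability P_b(n₁,n₂; p) that a random bipartite graph with partite sets of sizes n₁ and n₂ and edge probability p has diameter at most 3 satisfies P_b(n₁,n₂; p) ≥ 1 − (n₂²(1−p²)^{n₁}/2) · (1 + n₁²(1−p²)^{n₂−n₁}/n₂²). -/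
open scoped Classical

/-- The probability that a random bipartite graph — with partite sets of sizes `n₁` and
`n₂`, in which each of the `n₁ * n₂` possible edges between the two partite sets is
included independently with probability `p` — is connected with diameter at most `3`. -/
noncomputable def bipartiteDiam3Prob (n₁ n₂ : ℕ) (p : ℝ) : ℝ :=
  ∑ G : SimpleGraph (Fin n₁ ⊕ Fin n₂),
    if (∀ u v : Fin n₁ ⊕ Fin n₂, G.Adj u v → u.isLeft ≠ v.isLeft) ∧
        G.Connected ∧ ∀ u v : Fin n₁ ⊕ Fin n₂, G.dist u v ≤ 3 then
      p ^ Nat.card G.edgeSet * (1 - p) ^ (n₁ * n₂ - Nat.card G.edgeSet)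
    else 0

open Finset

/-- The probability that a Bernoulli variable of parameter `p` takes the value `b`. -/
def bernoulliWeight (p : ℝ) (b : Bool) : ℝ := if b then p else 1 - p

lemma bernoulliWeight_nonneg {p : ℝ} (hp0 : 0 ≤ p) (hp1 : p ≤ 1) (b : Bool) :
    0 ≤ bernoulliWeight p b := by
  cases b <;> simp [bernoulliWeight, hp0, hp1]

/-- The probability of the biadjacency matrix `f` when its entries are independent Bernoulli
variables of parameter `p`. -/
def biadjWeight {α β : Type*} [Fintype α] [Fintype β] (p : ℝ) (f : α → β → Bool) : ℝ :=
  ∏ i, ∏ j, bernoulliWeight p (f i j)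

section Weights

variable {α β : Type*} [Fintype α] [Fintype β]

lemma sum_pi_prod {κ : Type*} [Fintype κ] [DecidableEq β] (c : β → κ → ℝ) :
    ∑ g : β → κ, ∏ j, c j (g j) = ∏ j, ∑ b, c j b := by
  rw [Finset.prod_univ_sum, Fintype.piFinset_univ]

lemma biadjWeight_nonneg {p : ℝ} (hp0 : 0 ≤ p) (hp1 : p ≤ 1) (f : α → β → Bool) :
    0 ≤ biadjWeight p f :=
  prod_nonneg fun _ _ => prod_nonneg fun _ _ => bernoulliWeight_nonneg hp0 hp1 _

lemma biadjWeight_swap (p : ℝ) (f : α → β → Bool) :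
    biadjWeight p (Function.swap f) = biadjWeight p f :=
  prod_comm

lemma sum_prod_bernoulliWeight [DecidableEq β] (p : ℝ) :
    ∑ g : β → Bool, ∏ j, bernoulliWeight p (g j) = 1 := by
  rw [sum_pi_prod (fun _ => bernoulliWeight p)]
  simp [bernoulliWeight]

lemma sum_biadjWeight [DecidableEq α] [DecidableEq β] (p : ℝ) :
    ∑ f : α → β → Bool, biadjWeight p f = 1 := by
  unfold biadjWeight
  rw [sum_pi_prod (fun (_ : α) (g : β → Bool) => ∏ j, bernoulliWeight p (g j))]
  simp [sum_prod_bernoulliWeight]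

lemma sum_prod_bernoulliWeight_of_both [DecidableEq β] (p : ℝ) {u v : β} (huv : u ≠ v) :
    ∑ g : β → Bool, (∏ j, bernoulliWeight p (g j)) * (if g u ∧ g v then 1 else 0) = p ^ 2 := by
  have hterm : ∀ g : β → Bool,
      (∏ j, bernoulliWeight p (g j)) * (if g u ∧ g v then 1 else 0) =
        ∏ j, bernoulliWeight p (g j) * (if j ∈ ({u, v} : Finset β) ∧ ¬ g j then 0 else 1) := by
    intro g
    rw [prod_mul_distrib]
    congr 1
    split_ifs with h
    · refine (prod_eq_one fun j _ => if_neg ?_).symm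
      rintro ⟨hj, hg⟩
      rcases mem_insert.1 hj with rfl | hj
      · exact hg h.1
      · rw [mem_singleton.1 hj] at hg
        exact hg h.2
    · by_cases hu : g u
      · exact (prod_eq_zero (mem_univ v) (by simp [show ¬ g v from fun hv => h ⟨hu, hv⟩])).symm
      · exact (prod_eq_zero (mem_univ u) (by simp [hu])).symm
  simp_rw [hterm]
  rw [sum_pi_prod (fun j b => bernoulliWeight p b *
    (if j ∈ ({u, v} : Finset β) ∧ ¬ b then 0 else 1))]
  have hcol : ∀ j : β, ∑ b, bernoulliWeight p b *
      (if j ∈ ({u, v} : Finset β) ∧ ¬ b then (0 : ℝ) else 1) =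
        if j ∈ ({u, v} : Finset β) then p else 1 := by
    intro j
    by_cases hj : j ∈ ({u, v} : Finset β) <;> simp [bernoulliWeight, hj]
  simp_rw [hcol]
  rw [prod_ite_mem, univ_inter, prod_const, card_pair huv]

/-- Two distinct columns share no common `true` row with probability `(1 - p ^ 2) ^ |α|`. -/
lemma sum_biadjWeight_no_common [DecidableEq α] [DecidableEq β] (p : ℝ) {u v : β} (huv : u ≠ v) :
    ∑ f : α → β → Bool, biadjWeight p f * (if ∃ i, f i u ∧ f i v then 0 else 1) =
      (1 - p ^ 2) ^ Fintype.card α := by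
  have hterm : ∀ f : α → β → Bool,
      biadjWeight p f * (if ∃ i, f i u ∧ f i v then 0 else 1) =
        ∏ i, (∏ j, bernoulliWeight p (f i j)) * (1 - if f i u ∧ f i v then 1 else 0) := by
    intro f
    rw [prod_mul_distrib, biadjWeight]
    congr 1
    split_ifs with h
    · obtain ⟨i, hi⟩ := h
      exact (prod_eq_zero (mem_univ i) (by simp [hi])).symm
    · push Not at h
      exact (prod_eq_one fun i _ => by rw [if_neg fun hi => h i hi.1 hi.2, sub_zero]).symm
  simp_rw [hterm]
  rw [sum_pi_prod (fun (_ : α) (g : β → Bool) =>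
    (∏ j, bernoulliWeight p (g j)) * (1 - if g u ∧ g v then 1 else 0))]
  simp_rw [mul_sub, mul_one, sum_sub_distrib, sum_prod_bernoulliWeight,
    sum_prod_bernoulliWeight_of_both p huv, prod_const, card_univ]

/-- Any two distinct columns of `f` have a common `true` entry. -/
def ColumnsMeet (f : α → β → Bool) : Prop := ∀ u v, u ≠ v → ∃ i, f i u ∧ f i v

/-- The simple sieve: the columns fail to meet pairwise with probability at most
`|β| ^ 2 * (1 - p ^ 2) ^ |α| / 2`. -/
lemma sum_biadjWeight_not_columnsMeet_le [DecidableEq α] [DecidableEq β] {p : ℝ}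
    (hp0 : 0 ≤ p) (hp1 : p ≤ 1) :
    ∑ f : α → β → Bool, biadjWeight p f * (if ColumnsMeet f then 0 else 1) ≤
      (Fintype.card β : ℝ) ^ 2 * (1 - p ^ 2) ^ Fintype.card α / 2 := by
  have hpoint : ∀ f : α → β → Bool, (if ColumnsMeet f then (0 : ℝ) else 1) ≤
      (∑ q ∈ (univ : Finset β).offDiag, if ∃ i, f i q.1 ∧ f i q.2 then (0 : ℝ) else 1) / 2 := by
    intro f
    have hnn : ∀ q : β × β, 0 ≤ if ∃ i, f i q.1 ∧ f i q.2 then (0 : ℝ) else 1 := by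
      intro q; split_ifs <;> norm_num
    split_ifs with h
    · exact div_nonneg (sum_nonneg fun q _ => hnn q) zero_le_two
    · simp only [ColumnsMeet, not_forall] at h
      obtain ⟨u, v, huv, h⟩ := h
      have hsub : ({(u, v), (v, u)} : Finset (β × β)) ⊆ (univ : Finset β).offDiag := by
        intro q hq
        simp only [mem_insert, mem_singleton] at hq
        rcases hq with rfl | rfl <;> simp [huv, huv.symm]
      have hle := sum_le_sum_of_subset_of_nonneg hsub (fun q _ _ => hnn q)
      have h' : ¬ ∃ i, f i v ∧ f i u := fun ⟨i, hi⟩ => h ⟨i, hi.2, hi.1⟩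
      rw [sum_pair (by simp [huv]), if_neg h, if_neg h'] at hle
      linarith
  have hpow : 0 ≤ (1 - p ^ 2) ^ Fintype.card α := pow_nonneg (by nlinarith) _
  calc ∑ f : α → β → Bool, biadjWeight p f * (if ColumnsMeet f then 0 else 1)
      ≤ ∑ f : α → β → Bool, biadjWeight p f *
          ((∑ q ∈ (univ : Finset β).offDiag, if ∃ i, f i q.1 ∧ f i q.2 then 0 else 1) / 2) :=
        sum_le_sum fun f _ => mul_le_mul_of_nonneg_left (hpoint f) (biadjWeight_nonneg hp0 hp1 f)
    _ = (∑ q ∈ (univ : Finset β).offDiag, ∑ f : α → β → Bool,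
          biadjWeight p f * (if ∃ i, f i q.1 ∧ f i q.2 then 0 else 1)) / 2 := by
        rw [sum_comm, sum_div]
        exact sum_congr rfl fun f _ => by rw [← mul_sum, mul_div_assoc]
    _ = ((univ : Finset β).offDiag.card : ℝ) * (1 - p ^ 2) ^ Fintype.card α / 2 := by
        rw [sum_congr rfl fun q hq => sum_biadjWeight_no_common p (mem_offDiag.1 hq).2.2,
          sum_const, nsmul_eq_mul]
    _ ≤ (Fintype.card β : ℝ) ^ 2 * (1 - p ^ 2) ^ Fintype.card α / 2 := by
        have hcard : ((univ : Finset β).offDiag.card : ℝ) ≤ (Fintype.card β : ℝ) ^ 2 := by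
          rw [offDiag_card, card_univ, sq]
          exact_mod_cast Nat.sub_le _ _
        gcongr

lemma one_sub_le_sum_biadjWeight_columnsMeet [DecidableEq α] [DecidableEq β] {p : ℝ}
    (hp0 : 0 ≤ p) (hp1 : p ≤ 1) :
    1 - (Fintype.card β : ℝ) ^ 2 * (1 - p ^ 2) ^ Fintype.card α / 2 -
        (Fintype.card α : ℝ) ^ 2 * (1 - p ^ 2) ^ Fintype.card β / 2 ≤
      ∑ f : α → β → Bool, biadjWeight p f *
        (if ColumnsMeet f ∧ ColumnsMeet (Function.swap f) then 1 else 0) := by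
  have hcol := sum_biadjWeight_not_columnsMeet_le (α := α) (β := β) hp0 hp1
  have hrow := sum_biadjWeight_not_columnsMeet_le (α := β) (β := α) hp0 hp1
  rw [← Equiv.sum_comp (Equiv.piComm fun (_ : α) (_ : β) => Bool)] at hrow
  have hrow' : ∑ f : α → β → Bool, biadjWeight p f *
      (if ColumnsMeet (Function.swap f) then 0 else 1) ≤
        (Fintype.card α : ℝ) ^ 2 * (1 - p ^ 2) ^ Fintype.card β / 2 := by
    refine le_trans (le_of_eq (sum_congr rfl fun f _ => ?_)) hrow
    rw [← biadjWeight_swap]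
    rfl
  have hsplit : ∑ f : α → β → Bool, biadjWeight p f ≤ ∑ f : α → β → Bool,
      (biadjWeight p f * (if ColumnsMeet f ∧ ColumnsMeet (Function.swap f) then 1 else 0) +
        biadjWeight p f * (if ColumnsMeet f then 0 else 1) +
        biadjWeight p f * (if ColumnsMeet (Function.swap f) then 0 else 1)) := by
    refine sum_le_sum fun f _ => ?_
    have := biadjWeight_nonneg hp0 hp1 f
    by_cases hc : ColumnsMeet f <;> by_cases hr : ColumnsMeet (Function.swap f) <;>
      simp [hc, hr, this]
  rw [sum_add_distrib, sum_add_distrib, sum_biadjWeight] at hsplit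
  linarith

end Weights

section Graph

variable {α β : Type*}

/-- The bipartite graph with biadjacency matrix `f`. -/
def biadjGraph (f : α → β → Bool) : SimpleGraph (α ⊕ β) where
  Adj
    | .inl i, .inr j => f i j
    | .inr j, .inl i => f i j
    | _, _ => False
  symm := ⟨by rintro (i | i) (j | j) h <;> exact h⟩
  loopless := ⟨by rintro (i | i) h <;> exact h⟩

@[simp] lemma biadjGraph_adj_inl_inr (f : α → β → Bool) (i : α) (j : β) :
    (biadjGraph f).Adj (.inl i) (.inr j) ↔ f i j := Iff.rfl

@[simp] lemma biadjGraph_adj_inr_inl (f : α → β → Bool) (i : α) (j : β) :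
    (biadjGraph f).Adj (.inr j) (.inl i) ↔ f i j := Iff.rfl

lemma isLeft_ne_of_biadjGraph_adj (f : α → β → Bool) {u v : α ⊕ β}
    (h : (biadjGraph f).Adj u v) : u.isLeft ≠ v.isLeft := by
  rcases u with i | i <;> rcases v with j | j
  · exact h.elim
  · simp
  · simp
  · exact h.elim

lemma biadjGraph_injective :
    Function.Injective (biadjGraph : (α → β → Bool) → SimpleGraph (α ⊕ β)) := by
  intro f g h
  funext i j
  rw [Bool.eq_iff_iff, ← biadjGraph_adj_inl_inr, h, biadjGraph_adj_inl_inr]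

lemma edgeSet_biadjGraph (f : α → β → Bool) :
    (biadjGraph f).edgeSet =
      (fun q : α × β => s(Sum.inl q.1, Sum.inr q.2)) '' {q | f q.1 q.2} := by
  ext e
  induction e using Sym2.ind with
  | _ u v =>
    rw [SimpleGraph.mem_edgeSet]
    rcases u with i | i <;> rcases v with j | j
    · simp [biadjGraph]
    · simp
    · simp
    · simp [biadjGraph]

lemma card_edgeSet_biadjGraph [Fintype α] [Fintype β] (f : α → β → Bool) :
    Nat.card (biadjGraph f).edgeSet = #{q : α × β | f q.1 q.2} := by
  rw [edgeSet_biadjGraph, Nat.card_image_of_injective]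
  · simp [Fintype.card_subtype]
  · rintro ⟨i, j⟩ ⟨i', j'⟩ h
    simpa using h

lemma biadjWeight_eq [Fintype α] [Fintype β] (p : ℝ) (f : α → β → Bool) :
    biadjWeight p f = p ^ Nat.card (biadjGraph f).edgeSet *
      (1 - p) ^ (Fintype.card α * Fintype.card β - Nat.card (biadjGraph f).edgeSet) := by
  have hcompl : #{q : α × β | ¬ f q.1 q.2} =
      Fintype.card α * Fintype.card β - #{q : α × β | f q.1 q.2} := by
    have := card_filter_add_card_filter_not (s := (univ : Finset (α × β))) (fun q => f q.1 q.2)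
    rw [card_univ, Fintype.card_prod] at this
    omega
  rw [card_edgeSet_biadjGraph, ← hcompl, biadjWeight, ← Fintype.prod_prod_type']
  simp_rw [bernoulliWeight]
  rw [prod_ite, prod_const, prod_const]

/-- If all pairs of vertices in a common part have a common neighbour, any two vertices are
joined by a walk of length at most `3`. -/
lemma exists_walk_biadjGraph_length_le [Nontrivial α] [Nontrivial β] {f : α → β → Bool}
    (hcol : ColumnsMeet f) (hrow : ColumnsMeet (Function.swap f)) (u v : α ⊕ β) :
    ∃ w : (biadjGraph f).Walk u v, w.length ≤ 3 := by
  have hmixed : ∀ (i : α) (j : β),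
      ∃ w : (biadjGraph f).Walk (.inl i) (.inr j), w.length ≤ 3 := by
    intro i j
    obtain ⟨i', hi'⟩ := exists_ne i
    obtain ⟨k, hk, -⟩ := hrow i i' hi'.symm
    have hik : (biadjGraph f).Adj (.inl i) (.inr k) := hk
    by_cases hkj : k = j
    · subst hkj
      exact ⟨hik.toWalk, by simp⟩
    · obtain ⟨l, hlk, hlj⟩ := hcol k j hkj
      have hkl : (biadjGraph f).Adj (.inr k) (.inl l) := hlk
      have hlj' : (biadjGraph f).Adj (.inl l) (.inr j) := hlj
      exact ⟨.cons hik (.cons hkl hlj'.toWalk), by simp⟩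
  rcases u with i | i <;> rcases v with j | j
  · by_cases hij : i = j
    · subst hij
      exact ⟨.nil, by simp⟩
    · obtain ⟨k, hki, hkj⟩ := hrow i j hij
      have h₁ : (biadjGraph f).Adj (.inl i) (.inr k) := hki
      have h₂ : (biadjGraph f).Adj (.inr k) (.inl j) := hkj
      exact ⟨.cons h₁ h₂.toWalk, by simp⟩
  · exact hmixed i j
  · obtain ⟨w, hw⟩ := hmixed j i
    exact ⟨w.reverse, by simpa using hw⟩
  · by_cases hij : i = j
    · subst hij
      exact ⟨.nil, by simp⟩
    · obtain ⟨k, hki, hkj⟩ := hcol i j hij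
      have h₁ : (biadjGraph f).Adj (.inr i) (.inl k) := hki
      have h₂ : (biadjGraph f).Adj (.inl k) (.inr j) := hkj
      exact ⟨.cons h₁ h₂.toWalk, by simp⟩

end Graph

lemma sum_biadjWeight_columnsMeet_le_bipartiteDiam3Prob {n₁ n₂ : ℕ} (h₁ : 2 ≤ n₁) (h₂ : 2 ≤ n₂)
    {p : ℝ} (hp0 : 0 ≤ p) (hp1 : p ≤ 1) :
    ∑ f : Fin n₁ → Fin n₂ → Bool, biadjWeight p f *
        (if ColumnsMeet f ∧ ColumnsMeet (Function.swap f) then 1 else 0) ≤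
      bipartiteDiam3Prob n₁ n₂ p := by
  have : Nontrivial (Fin n₁) := Fin.nontrivial_iff_two_le.2 h₁
  have : Nontrivial (Fin n₂) := Fin.nontrivial_iff_two_le.2 h₂
  have hweight : ∀ m k : ℕ, 0 ≤ p ^ m * (1 - p) ^ k := fun m k =>
    mul_nonneg (pow_nonneg hp0 _) (pow_nonneg (sub_nonneg.2 hp1) _)
  unfold bipartiteDiam3Prob
  refine le_trans ?_ (sum_le_sum_of_subset_of_nonneg
    (subset_univ (univ.map ⟨biadjGraph, biadjGraph_injective⟩)) fun G _ _ => ?_)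
  · rw [sum_map]
    refine sum_le_sum fun f _ => ?_
    by_cases h : ColumnsMeet f ∧ ColumnsMeet (Function.swap f)
    · have hwalk := exists_walk_biadjGraph_length_le h.1 h.2
      have hconn : (biadjGraph f).Connected :=
        ⟨fun u v => (hwalk u v).elim fun w _ => w.reachable⟩
      have hdist : ∀ u v, (biadjGraph f).dist u v ≤ 3 := fun u v =>
        (hwalk u v).elim fun w hw => (SimpleGraph.dist_le w).trans hw
      rw [if_pos h, mul_one, Function.Embedding.coeFn_mk,
        if_pos ⟨fun _ _ => isLeft_ne_of_biadjGraph_adj f, hconn, hdist⟩, biadjWeight_eq,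
        Fintype.card_fin, Fintype.card_fin]
    · rw [if_neg h, mul_zero]
      split_ifs
      exacts [hweight _ _, le_rfl]
  · split_ifs
    exacts [hweight _ _, le_rfl]

/-- Simple-sieve lower bound for random bipartite graphs having diameter at most 3. -/
theorem bipartiteDiam3Prob_lower (n₁ n₂ n : ℕ) (h1 : 2 ≤ n₁) (h12 : n₁ ≤ n₂)
    (hn : n₁ + n₂ = n) (hn4 : 4 ≤ n) (p : ℝ) (hp0 : 0 ≤ p) (hp1 : p ≤ 1) :
    1 - ((n₂ : ℝ) ^ 2 * (1 - p ^ 2) ^ n₁ / 2) *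
        (1 + (n₁ : ℝ) ^ 2 * (1 - p ^ 2) ^ (n₂ - n₁) / (n₂ : ℝ) ^ 2) ≤
      bipartiteDiam3Prob n₁ n₂ p := by
  have hsieve := one_sub_le_sum_biadjWeight_columnsMeet (α := Fin n₁) (β := Fin n₂) hp0 hp1
  have hgraph := sum_biadjWeight_columnsMeet_le_bipartiteDiam3Prob h1 (h1.trans h12) hp0 hp1
  simp only [Fintype.card_fin] at hsieve
  refine le_trans (le_of_eq ?_) (hsieve.trans hgraph)
  have hn₂ : (n₂ : ℝ) ≠ 0 := by
    have : n₂ ≠ 0 := by omega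
    exact_mod_cast this
  have hpow : (1 - p ^ 2) ^ n₂ = (1 - p ^ 2) ^ n₁ * (1 - p ^ 2) ^ (n₂ - n₁) := by
    rw [← pow_add, Nat.add_sub_cancel' h12]
  rw [hpow]
  field_simp
  ring
end

section
/- Let n₁, n₂ be integers with 2 ≤ n₁ ≤ n₂ and n₁ + n₂ = n ≥ 4. Then for every p ∈ (0,1), the probability P_b(n₁,n₂; p) that a random bipartite graph with partite sets of sizes n₁ and n₂ and edge probability p has diameter at most 3 satisfies P_b(n₁,n₂; p) ≤ (2/(n₂(n₂−1)(1−p²)^{n₁}) + ((1 + p³/(1−p))^{n₁}/n₂)·(8 + 8/(1−p))) · (1 + n₁(n₁−1)(1−p²)^{n₂−n₁}/(n₂(n₂−1)))^{−1}. -/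
open scoped Classical

/-- Expectation of `F` under the product measure on `I → Bool` giving `true` mass `p`. -/
noncomputable def bernoulliExp {I : Type*} [Fintype I] (p : ℝ) (F : (I → Bool) → ℝ) : ℝ :=
  ∑ f : I → Bool, (∏ i, if f i then p else 1 - p) * F f

/-- The `0`-`1` coordinate variable at `i`. -/
def coordVar {I : Type*} (i : I) (f : I → Bool) : ℝ := if f i then 1 else 0

/-- Given an incidence array `φ : A → B → I`, the indicator that `c` and `d` have no common
neighbour in `A`. -/
noncomputable def noCommon {I A B : Type*} [Fintype A] (φ : A → B → I) (c d : B)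
    (f : I → Bool) : ℝ :=
  ∏ a, (1 - coordVar (φ a c) f * coordVar (φ a d) f)

/-- The number of ordered pairs of distinct elements of `B` without a common neighbour. -/
noncomputable def noCommonCount {I A B : Type*} [Fintype A] [Fintype B] [DecidableEq B]
    (φ : A → B → I) (f : I → Bool) : ℝ :=
  ∑ x ∈ (Finset.univ : Finset B).offDiag, noCommon φ x.1 x.2 f

section DependsOn

variable {I : Type*}

theorem DependsOn.finsetProd {J : Type*} {s : Finset J} {F : J → (I → Bool) → ℝ}
    {S : J → Set I} {T : Set I} (hF : ∀ j ∈ s, DependsOn (F j) (S j)) (hT : ∀ j ∈ s, S j ⊆ T) :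
    DependsOn (fun f => ∏ j ∈ s, F j f) T :=
  fun _ _ h => Finset.prod_congr rfl fun j hj => hF j hj fun i hi => h i (hT j hj hi)

theorem coordVar_mul_self (i : I) (f : I → Bool) : coordVar i f * coordVar i f = coordVar i f := by
  simp [coordVar]

theorem dependsOn_coordVar {i : I} {S : Set I} (h : i ∈ S) : DependsOn (coordVar i) S :=
  fun f g hfg => by simp [coordVar, hfg i h]

theorem DependsOn.mul' {F G : (I → Bool) → ℝ} {S : Set I} (hF : DependsOn F S)
    (hG : DependsOn G S) : DependsOn (fun f => F f * G f) S :=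
  fun _ _ h => congrArg₂ _ (hF h) (hG h)

theorem DependsOn.sub' {F G : (I → Bool) → ℝ} {S : Set I} (hF : DependsOn F S)
    (hG : DependsOn G S) : DependsOn (fun f => F f - G f) S :=
  fun _ _ h => congrArg₂ _ (hF h) (hG h)

theorem dependsOn_one_sub_mul {i j : I} {S : Set I} (hi : i ∈ S) (hj : j ∈ S) :
    DependsOn (fun f => 1 - coordVar i f * coordVar j f) S :=
  DependsOn.sub' (fun _ _ _ => rfl)
    (DependsOn.mul' (dependsOn_coordVar hi) (dependsOn_coordVar hj))

end DependsOn

section Expectation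

variable {I : Type*} [Fintype I] {p : ℝ}

theorem sum_bernoulli_weight (p : ℝ) :
    ∑ f : I → Bool, (∏ i, if f i then p else 1 - p) = 1 := by
  classical
  have h := Finset.prod_univ_sum (fun _ : I => (Finset.univ : Finset Bool))
    (fun _ b => if b then p else 1 - p)
  rw [Fintype.piFinset_univ] at h
  rw [← h]
  simp

theorem bernoulliExp_const (p c : ℝ) : bernoulliExp p (fun _ : I → Bool => c) = c := by
  simp only [bernoulliExp]
  rw [← Finset.sum_mul, sum_bernoulli_weight, one_mul]

theorem bernoulliExp_add (F G : (I → Bool) → ℝ) :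
    bernoulliExp p (fun f => F f + G f) = bernoulliExp p F + bernoulliExp p G := by
  simp only [bernoulliExp, mul_add, Finset.sum_add_distrib]

theorem bernoulliExp_sub (F G : (I → Bool) → ℝ) :
    bernoulliExp p (fun f => F f - G f) = bernoulliExp p F - bernoulliExp p G := by
  simp only [bernoulliExp, mul_sub, Finset.sum_sub_distrib]

theorem bernoulliExp_const_mul (c : ℝ) (F : (I → Bool) → ℝ) :
    bernoulliExp p (fun f => c * F f) = c * bernoulliExp p F := by
  simp only [bernoulliExp, Finset.mul_sum]
  exact Finset.sum_congr rfl fun f _ => by ring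

theorem bernoulliExp_sum {J : Type*} (s : Finset J) (F : J → (I → Bool) → ℝ) :
    bernoulliExp p (fun f => ∑ j ∈ s, F j f) = ∑ j ∈ s, bernoulliExp p (F j) := by
  simp only [bernoulliExp, Finset.mul_sum]
  exact Finset.sum_comm

theorem bernoulli_weight_nonneg (hp0 : 0 ≤ p) (hp1 : p ≤ 1) (f : I → Bool) :
    0 ≤ ∏ i, (if f i then p else 1 - p) :=
  Finset.prod_nonneg fun i _ => by split_ifs <;> linarith

theorem bernoulliExp_mono (hp0 : 0 ≤ p) (hp1 : p ≤ 1) {F G : (I → Bool) → ℝ}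
    (h : ∀ f, F f ≤ G f) : bernoulliExp p F ≤ bernoulliExp p G :=
  Finset.sum_le_sum fun f _ =>
    mul_le_mul_of_nonneg_left (h f) (bernoulli_weight_nonneg hp0 hp1 f)

theorem bernoulliExp_mul_of_disjoint {F G : (I → Bool) → ℝ} {S T : Set I}
    (hF : DependsOn F S) (hG : DependsOn G T) (hST : Disjoint S T) :
    bernoulliExp p (fun f => F f * G f) = bernoulliExp p F * bernoulliExp p G := by
  classical
  let e := Equiv.piEquivPiSubtypeProd (· ∈ S) (fun _ : I => Bool)
  let g₀ : {i // i ∈ S} → Bool := fun _ => true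
  let h₀ : {i // i ∉ S} → Bool := fun _ => true
  have weight (x : ({i // i ∈ S} → Bool) × ({i // i ∉ S} → Bool)) :
      ∏ i, (if e.symm x i then p else 1 - p) =
        (∏ i, if x.1 i then p else 1 - p) * ∏ i, if x.2 i then p else 1 - p := by
    rw [← Fintype.prod_subtype_mul_prod_subtype (· ∈ S)]
    congr 1 <;> refine Finset.prod_congr rfl fun i _ => ?_
    · simp [e, Equiv.piEquivPiSubtypeProd, i.2]
    · simp [e, Equiv.piEquivPiSubtypeProd, i.2]
  have hF' (x : ({i // i ∈ S} → Bool) × ({i // i ∉ S} → Bool)) :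
      F (e.symm x) = F (e.symm (x.1, h₀)) :=
    hF fun i hi => by simp [e, Equiv.piEquivPiSubtypeProd, hi]
  have hG' (x : ({i // i ∈ S} → Bool) × ({i // i ∉ S} → Bool)) :
      G (e.symm x) = G (e.symm (g₀, x.2)) :=
    hG fun i hi => by
      have : i ∉ S := fun h => Set.disjoint_left.1 hST h hi
      simp [e, Equiv.piEquivPiSubtypeProd, this]
  have key (H : (I → Bool) → ℝ) (u : ({i // i ∈ S} → Bool) → ℝ)
      (v : ({i // i ∉ S} → Bool) → ℝ) (hH : ∀ x, H (e.symm x) = u x.1 * v x.2) :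
      bernoulliExp p H = bernoulliExp p u * bernoulliExp p v := by
    simp only [bernoulliExp]
    rw [← Equiv.sum_comp e.symm, Finset.sum_mul_sum, Fintype.sum_prod_type]
    refine Finset.sum_congr (by ext; simp) fun g _ => Finset.sum_congr (by ext; simp) fun h _ => ?_
    rw [weight, hH]
    ring
  rw [key _ (fun g => F (e.symm (g, h₀))) (fun h => G (e.symm (g₀, h)))
      (fun x => by rw [hF', hG']),
    key F (fun g => F (e.symm (g, h₀))) (fun _ => 1) (fun x => by rw [hF', mul_one]),
    key G (fun _ => 1) (fun h => G (e.symm (g₀, h))) (fun x => by rw [hG', one_mul]),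
    bernoulliExp_const, bernoulliExp_const]
  ring

theorem bernoulliExp_prod {J : Type*} (s : Finset J) (F : J → (I → Bool) → ℝ) (S : J → Set I)
    (hF : ∀ j, DependsOn (F j) (S j)) (hS : Pairwise (Function.onFun Disjoint S)) :
    bernoulliExp p (fun f => ∏ j ∈ s, F j f) = ∏ j ∈ s, bernoulliExp p (F j) := by
  classical
  induction s using Finset.induction_on with
  | empty => simp [bernoulliExp_const]
  | insert a s ha ih =>
    simp only [Finset.prod_insert ha]
    rw [bernoulliExp_mul_of_disjoint (hF a)
      (DependsOn.finsetProd (T := ⋃ j ∈ s, S j) (fun j _ => hF j)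
        fun j hj => Set.subset_biUnion_of_mem (u := S) hj), ih]
    rw [Set.disjoint_iUnion₂_right]
    exact fun j hj => hS fun h => ha (h ▸ hj)

theorem bernoulliExp_coordVar (i : I) : bernoulliExp p (coordVar i) = p := by
  classical
  have h := Finset.prod_univ_sum (fun _ : I => (Finset.univ : Finset Bool))
    (fun j b => (if b then p else 1 - p) * (if j = i then (if b then 1 else 0) else 1))
  rw [Fintype.piFinset_univ] at h
  have h2 : bernoulliExp p (coordVar i) = ∑ f : I → Bool, ∏ j,
      ((if f j then p else 1 - p) * (if j = i then (if f j then 1 else 0) else 1)) := by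
    refine Finset.sum_congr rfl fun f _ => ?_
    rw [Finset.prod_mul_distrib]
    simp [coordVar]
  rw [h2, ← h]
  rw [Finset.prod_eq_single i]
  · simp
  · intro j _ hj
    simp [hj]
  · simp

theorem bernoulliExp_coordVar_mul {i j : I} (hij : i ≠ j) :
    bernoulliExp p (fun f => coordVar i f * coordVar j f) = p ^ 2 := by
  rw [bernoulliExp_mul_of_disjoint (dependsOn_coordVar (Set.mem_singleton i))
    (dependsOn_coordVar (Set.mem_singleton j)) (by simpa using hij)]
  simp only [bernoulliExp_coordVar, sq]

theorem bernoulliExp_one_sub_mul {i j : I} (hij : i ≠ j) :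
    bernoulliExp p (fun f => 1 - coordVar i f * coordVar j f) = 1 - p ^ 2 := by
  rw [bernoulliExp_sub, bernoulliExp_const, bernoulliExp_coordVar_mul hij]

theorem bernoulliExp_cherry {i j k : I} (hij : i ≠ j) (hik : i ≠ k) (hjk : j ≠ k) :
    bernoulliExp p (fun f => (1 - coordVar i f * coordVar j f) *
      (1 - coordVar i f * coordVar k f)) = 1 - 2 * p ^ 2 + p ^ 3 := by
  have h : (fun f : I → Bool => (1 - coordVar i f * coordVar j f) *
      (1 - coordVar i f * coordVar k f)) = fun f =>
      ((1 - coordVar i f * coordVar j f) - coordVar i f * coordVar k f) +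
        (coordVar i f * coordVar j f) * coordVar k f := by
    funext f
    linear_combination (coordVar j f * coordVar k f) * coordVar_mul_self i f
  rw [h, bernoulliExp_add, bernoulliExp_sub, bernoulliExp_one_sub_mul hij,
    bernoulliExp_coordVar_mul hik,
    bernoulliExp_mul_of_disjoint (S := {i, j}) (T := {k})
      (DependsOn.mul' (dependsOn_coordVar (by simp)) (dependsOn_coordVar (by simp)))
      (dependsOn_coordVar (by simp)) (by simp [hik.symm, hjk.symm]),
    bernoulliExp_coordVar_mul hij, bernoulliExp_coordVar]
  ring

theorem bernoulliExp_one_sub_mul_one_sub {i j : I} (hij : i ≠ j) :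
    bernoulliExp p (fun f => (1 - coordVar i f) * (1 - coordVar j f)) = (1 - p) ^ 2 := by
  rw [bernoulliExp_mul_of_disjoint (S := {i}) (T := {j})
    (DependsOn.sub' (fun _ _ _ => rfl) (dependsOn_coordVar (by simp)))
    (DependsOn.sub' (fun _ _ _ => rfl) (dependsOn_coordVar (by simp))) (by simpa using hij)]
  simp only [bernoulliExp_sub, bernoulliExp_const, bernoulliExp_coordVar, sq]

theorem bernoulliExp_fourCycle {i j k l : I} (hij : i ≠ j) (hik : i ≠ k) (hil : i ≠ l)
    (hjk : j ≠ k) (hjl : j ≠ l) (hkl : k ≠ l) :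
    bernoulliExp p (fun f => ((1 - coordVar i f * coordVar j f) *
      (1 - coordVar k f * coordVar l f)) * ((1 - coordVar i f * coordVar l f) *
      (1 - coordVar j f * coordVar k f))) = (1 - p) ^ 2 * (1 + 2 * p - p ^ 2) := by
  have h : (fun f : I → Bool => ((1 - coordVar i f * coordVar j f) *
      (1 - coordVar k f * coordVar l f)) * ((1 - coordVar i f * coordVar l f) *
      (1 - coordVar j f * coordVar k f))) = fun f =>
      (1 - coordVar i f) * (1 - coordVar k f) +
      (1 - (1 - coordVar i f) * (1 - coordVar k f)) *
        ((1 - coordVar j f) * (1 - coordVar l f)) := by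
    funext f
    simp only [coordVar]
    cases f i <;> cases f j <;> cases f k <;> cases f l <;> simp
  rw [h, bernoulliExp_add,
    bernoulliExp_mul_of_disjoint (S := {i, k}) (T := {j, l})
      (F := fun f => 1 - (1 - coordVar i f) * (1 - coordVar k f))
      (G := fun f => (1 - coordVar j f) * (1 - coordVar l f))
      (DependsOn.sub' (fun _ _ _ => rfl) (DependsOn.mul'
        (DependsOn.sub' (fun _ _ _ => rfl) (dependsOn_coordVar (by simp)))
        (DependsOn.sub' (fun _ _ _ => rfl) (dependsOn_coordVar (by simp)))))
      (DependsOn.mul'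
        (DependsOn.sub' (fun _ _ _ => rfl) (dependsOn_coordVar (by simp)))
        (DependsOn.sub' (fun _ _ _ => rfl) (dependsOn_coordVar (by simp))))
      (by simp [hij.symm, hil.symm, hjk, hkl.symm]),
    bernoulliExp_sub, bernoulliExp_const, bernoulliExp_one_sub_mul_one_sub hik,
    bernoulliExp_one_sub_mul_one_sub hjl]
  ring

end Expectation

theorem noCommon_comm {I A B : Type*} [Fintype A] (φ : A → B → I) (c d : B) (f : I → Bool) :
    noCommon φ c d f = noCommon φ d c f :=
  Finset.prod_congr rfl fun a _ => by rw [mul_comm]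

theorem noCommon_mul_self {I A B : Type*} [Fintype A] (φ : A → B → I) (c d : B) (f : I → Bool) :
    noCommon φ c d f * noCommon φ c d f = noCommon φ c d f := by
  simp only [noCommon, ← Finset.prod_mul_distrib]
  refine Finset.prod_congr rfl fun a _ => ?_
  simp only [coordVar]
  cases f (φ a c) <;> cases f (φ a d) <;> simp

section OneSide

variable {I A B : Type*} [Fintype I] [Fintype A] {p : ℝ} {φ : A → B → I}

theorem bernoulliExp_noCommon (hφ : Function.Injective2 φ) {c d : B} (hcd : c ≠ d) :
    bernoulliExp p (noCommon φ c d) = (1 - p ^ 2) ^ Fintype.card A := by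
  have h := bernoulliExp_prod (p := p) Finset.univ
    (fun a f => 1 - coordVar (φ a c) f * coordVar (φ a d) f) (fun a => {φ a c, φ a d})
    (fun a => dependsOn_one_sub_mul (by simp) (by simp)) (by
      intro a b hab
      simp [Function.onFun, hφ.eq_iff, hab.symm])
  refine h.trans ?_
  rw [Finset.prod_congr rfl fun a _ => bernoulliExp_one_sub_mul (p := p)
    (i := φ a c) (j := φ a d) (by simp [hφ.eq_iff, hcd])]
  simp

theorem bernoulliExp_noCommon_cherry (hφ : Function.Injective2 φ) {c d e : B} (hcd : c ≠ d)
    (hce : c ≠ e) (hde : d ≠ e) :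
    bernoulliExp p (fun f => noCommon φ c d f * noCommon φ c e f) =
      (1 - 2 * p ^ 2 + p ^ 3) ^ Fintype.card A := by
  simp only [noCommon, ← Finset.prod_mul_distrib]
  rw [bernoulliExp_prod (p := p) Finset.univ _ (fun a => {φ a c, φ a d, φ a e})
    (fun a => DependsOn.mul' (dependsOn_one_sub_mul (by simp) (by simp))
      (dependsOn_one_sub_mul (by simp) (by simp))) (by
      intro a b hab
      simp [Function.onFun, hφ.eq_iff, hab.symm])]
  rw [Finset.prod_congr rfl fun a _ => bernoulliExp_cherry (p := p)
    (i := φ a c) (j := φ a d) (k := φ a e) (by simp [hφ.eq_iff, hcd]) (by simp [hφ.eq_iff, hce])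
    (by simp [hφ.eq_iff, hde])]
  simp

theorem bernoulliExp_noCommon_disjoint (hφ : Function.Injective2 φ) {c d c' d' : B}
    (h₁ : c ≠ c') (h₂ : c ≠ d') (h₃ : d ≠ c') (h₄ : d ≠ d') :
    bernoulliExp p (fun f => noCommon φ c d f * noCommon φ c' d' f) =
      bernoulliExp p (noCommon φ c d) * bernoulliExp p (noCommon φ c' d') := by
  refine bernoulliExp_mul_of_disjoint (S := {i | ∃ a, i = φ a c ∨ i = φ a d})
    (T := {i | ∃ a, i = φ a c' ∨ i = φ a d'})
    (DependsOn.finsetProd (S := fun _ => {i | ∃ a, i = φ a c ∨ i = φ a d})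
      (fun a _ => dependsOn_one_sub_mul ⟨a, Or.inl rfl⟩ ⟨a, Or.inr rfl⟩) fun _ _ => subset_rfl)
    (DependsOn.finsetProd (S := fun _ => {i | ∃ a, i = φ a c' ∨ i = φ a d'})
      (fun a _ => dependsOn_one_sub_mul ⟨a, Or.inl rfl⟩ ⟨a, Or.inr rfl⟩) fun _ _ => subset_rfl) ?_
  rw [Set.disjoint_left]
  rintro i ⟨a, ha⟩ ⟨b, hb⟩
  rcases ha with rfl | rfl <;> rcases hb with hb | hb <;> have := (hφ hb).2 <;> tauto

theorem cov_noCommon_le [DecidableEq B] (hφ : Function.Injective2 φ) (hp0 : 0 ≤ p) (hp1 : p ≤ 1)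
    {c d c' d' : B} (hcd : c ≠ d) (hcd' : c' ≠ d') :
    bernoulliExp p (fun f => noCommon φ c d f * noCommon φ c' d' f) -
        bernoulliExp p (noCommon φ c d) * bernoulliExp p (noCommon φ c' d') ≤
      (1 - p ^ 2) ^ Fintype.card A *
          ((if c' = c ∧ d' = d then 1 else 0) + (if c' = d ∧ d' = c then 1 else 0)) +
        (1 - 2 * p ^ 2 + p ^ 3) ^ Fintype.card A *
          ((if c' = c then 1 else 0) + (if c' = d then 1 else 0) +
            ((if d' = c then 1 else 0) + (if d' = d then 1 else 0))) := by
  have hq : 0 ≤ 1 - p ^ 2 := by nlinarith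
  have ht : 0 ≤ 1 - 2 * p ^ 2 + p ^ 3 := by
    have : 1 - 2 * p ^ 2 + p ^ 3 = (1 - p) * (1 + p * (1 - p)) := by ring
    rw [this]
    have := mul_nonneg hp0 (sub_nonneg.2 hp1)
    exact mul_nonneg (by linarith) (by linarith)
  have hQ := pow_nonneg hq (Fintype.card A)
  have hT := pow_nonneg ht (Fintype.card A)
  have hE : 0 ≤ bernoulliExp p (noCommon φ c d) * bernoulliExp p (noCommon φ c' d') := by
    rw [bernoulliExp_noCommon hφ hcd, bernoulliExp_noCommon hφ hcd']
    positivity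
  by_cases h1 : c' = c
  · subst h1
    by_cases h2 : d' = d
    · subst h2
      simp only [noCommon_mul_self]
      have := bernoulliExp_noCommon (p := p) hφ hcd
      simp only [hcd, hcd.symm]
      simp only [and_self, if_true, if_false]
      have e : bernoulliExp p (fun f => noCommon φ c' d' f) = (1 - p ^ 2) ^ Fintype.card A := this
      rw [e]
      linarith [mul_nonneg hQ hQ]
    · rw [bernoulliExp_noCommon_cherry hφ hcd hcd' (Ne.symm h2)]
      simp only [h2, hcd, hcd'.symm]
      simp
      linarith
  by_cases h2 : c' = d
  · subst h2
    simp only [noCommon_comm φ c c'] at hE ⊢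
    by_cases h3 : d' = c
    · subst h3
      simp only [noCommon_mul_self]
      have e : bernoulliExp p (fun f => noCommon φ c' d' f) = (1 - p ^ 2) ^ Fintype.card A :=
        bernoulliExp_noCommon (p := p) hφ hcd'
      simp only [h1, hcd]
      simp
      have e2 : bernoulliExp p (noCommon φ d' c') = bernoulliExp p (noCommon φ c' d') := by
        congr 1
        funext f
        exact noCommon_comm φ d' c' f
      rw [e2, e]
      linarith [mul_nonneg hQ hQ]
    · rw [bernoulliExp_noCommon_cherry hφ hcd.symm hcd' (Ne.symm h3)]
      simp only [h3, h1, hcd'.symm]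
      simp
      linarith
  by_cases h3 : d' = c
  · subst h3
    simp only [noCommon_comm φ c' d']
    rw [bernoulliExp_noCommon_cherry hφ hcd hcd'.symm (Ne.symm h2)]
    simp only [h1, h2, hcd]
    simp
    linarith
  by_cases h4 : d' = d
  · subst h4
    simp only [noCommon_comm φ c' d', noCommon_comm φ c d']
    rw [bernoulliExp_noCommon_cherry hφ hcd.symm hcd'.symm (Ne.symm h1)]
    simp only [h1, h2, h3]
    simp
    linarith
  rw [bernoulliExp_noCommon_disjoint hφ (Ne.symm h1) (Ne.symm h3) (Ne.symm h2) (Ne.symm h4)]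
  simp [h1, h2, h3, h4]

theorem sum_offDiag_ite_fst {B : Type*} [Fintype B] [DecidableEq B] (c : B) :
    ∑ y ∈ (Finset.univ : Finset B).offDiag, (if y.1 = c then (1 : ℝ) else 0) =
      Fintype.card B - 1 := by
  have h : (Finset.univ : Finset B).offDiag.filter (fun y => y.1 = c) =
      (Finset.univ.erase c).image (fun b => (c, b)) := by
    ext ⟨a, b⟩
    simp only [Finset.mem_filter, Finset.mem_offDiag, Finset.mem_image, Finset.mem_erase,
      Finset.mem_univ, Prod.mk.injEq, true_and, and_true]
    constructor
    · rintro ⟨hab, rfl⟩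
      exact ⟨b, Ne.symm hab, rfl, rfl⟩
    · rintro ⟨x, hx, rfl, rfl⟩
      exact ⟨Ne.symm hx, rfl⟩
  rw [Finset.sum_boole, h, Finset.card_image_of_injective _ (fun _ _ h => by simpa using h),
    Finset.card_erase_of_mem (Finset.mem_univ _), Finset.card_univ,
    Nat.cast_pred (Fintype.card_pos_iff.2 ⟨c⟩)]

theorem sum_offDiag_ite_snd {B : Type*} [Fintype B] [DecidableEq B] (c : B) :
    ∑ y ∈ (Finset.univ : Finset B).offDiag, (if y.2 = c then (1 : ℝ) else 0) =
      Fintype.card B - 1 := by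
  rw [← sum_offDiag_ite_fst c]
  refine Finset.sum_nbij' Prod.swap Prod.swap ?_ ?_ ?_ ?_ ?_ <;> simp [eq_comm]

theorem sum_offDiag_ite_eq {B : Type*} [Fintype B] [DecidableEq B] {c d : B} (hcd : c ≠ d) :
    ∑ y ∈ (Finset.univ : Finset B).offDiag, (if y.1 = c ∧ y.2 = d then (1 : ℝ) else 0) = 1 := by
  rw [Finset.sum_eq_single (c, d)]
  · simp
  · rintro ⟨a, b⟩ _ h
    simpa using h
  · simp [hcd]

theorem card_offDiag_univ (B : Type*) [Fintype B] [DecidableEq B] :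
    ((Finset.univ : Finset B).offDiag.card : ℝ) =
      Fintype.card B * ((Fintype.card B : ℝ) - 1) := by
  rw [Finset.offDiag_card, Finset.card_univ, Nat.cast_sub (Nat.le_mul_self _)]
  push_cast
  ring

theorem bernoulliExp_noCommonCount [Fintype B] [DecidableEq B] (hφ : Function.Injective2 φ) :
    bernoulliExp p (noCommonCount φ) =
      Fintype.card B * ((Fintype.card B : ℝ) - 1) * (1 - p ^ 2) ^ Fintype.card A := by
  have h : bernoulliExp p (noCommonCount φ) =
      ∑ x ∈ (Finset.univ : Finset B).offDiag, bernoulliExp p (noCommon φ x.1 x.2) :=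
    bernoulliExp_sum _ _
  rw [h, Finset.sum_congr rfl fun x hx =>
    bernoulliExp_noCommon (p := p) hφ (Finset.mem_offDiag.1 hx).2.2]
  rw [Finset.sum_const, nsmul_eq_mul, card_offDiag_univ]

theorem cov_sum {J K : Type*} (s : Finset J) (t : Finset K) (F : J → (I → Bool) → ℝ)
    (G : K → (I → Bool) → ℝ) :
    bernoulliExp p (fun f => (∑ j ∈ s, F j f) * ∑ k ∈ t, G k f) -
        bernoulliExp p (fun f => ∑ j ∈ s, F j f) * bernoulliExp p (fun f => ∑ k ∈ t, G k f) =
      ∑ j ∈ s, ∑ k ∈ t, (bernoulliExp p (fun f => F j f * G k f) -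
        bernoulliExp p (F j) * bernoulliExp p (G k)) := by
  simp only [Finset.sum_mul_sum, bernoulliExp_sum, Finset.sum_sub_distrib]

theorem variance_noCommonCount_le [Fintype B] [DecidableEq B] (hφ : Function.Injective2 φ)
    (hp0 : 0 ≤ p) (hp1 : p ≤ 1) :
    bernoulliExp p (fun f => noCommonCount φ f * noCommonCount φ f) -
        bernoulliExp p (noCommonCount φ) * bernoulliExp p (noCommonCount φ) ≤
      Fintype.card B * ((Fintype.card B : ℝ) - 1) * (2 * (1 - p ^ 2) ^ Fintype.card A +
        4 * ((Fintype.card B : ℝ) - 1) * (1 - 2 * p ^ 2 + p ^ 3) ^ Fintype.card A) := by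
  refine (cov_sum _ _ _ _).trans_le ?_
  rw [← card_offDiag_univ, ← nsmul_eq_mul]
  refine Finset.sum_le_card_nsmul _ _ _ fun x hx => ?_
  have hx' := (Finset.mem_offDiag.1 hx).2.2
  refine (Finset.sum_le_sum fun y hy =>
    cov_noCommon_le hφ hp0 hp1 hx' (Finset.mem_offDiag.1 hy).2.2).trans_eq ?_
  simp only [Finset.sum_add_distrib, ← Finset.mul_sum, sum_offDiag_ite_fst, sum_offDiag_ite_snd,
    sum_offDiag_ite_eq hx', sum_offDiag_ite_eq hx'.symm]
  ring

end OneSide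

theorem injective2_flip {I A B : Type*} {φ : A → B → I} (hφ : Function.Injective2 φ) :
    Function.Injective2 (flip φ) :=
  fun _ _ _ _ h => (hφ h).symm

theorem noCommon_eq_mul_prod_erase {I A B : Type*} [Fintype A] [DecidableEq A]
    (φ : A → B → I) {a b : A} (hab : a ≠ b) (c d : B) (f : I → Bool) :
    noCommon φ c d f = ((1 - coordVar (φ a c) f * coordVar (φ a d) f) *
      (1 - coordVar (φ b c) f * coordVar (φ b d) f)) *
      ∏ x ∈ (Finset.univ.erase a).erase b, (1 - coordVar (φ x c) f * coordVar (φ x d) f) := by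
  let g (x : A) : ℝ := 1 - coordVar (φ x c) f * coordVar (φ x d) f
  have h1 := Finset.mul_prod_erase (Finset.univ.erase a) g (a := b) (by simp [hab.symm])
  have h2 := Finset.mul_prod_erase Finset.univ g (Finset.mem_univ a)
  rw [mul_assoc]
  exact (h2.symm.trans (by rw [← h1]) : ∏ x, g x = _)

theorem card_erase_erase_add_two {A : Type*} [Fintype A] [DecidableEq A] {a b : A} (hab : a ≠ b) :
    ((Finset.univ.erase a).erase b).card + 2 = Fintype.card A := by
  have h1 := Finset.card_erase_add_one (s := Finset.univ.erase a) (a := b) (by simp [hab.symm])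
  have h2 := Finset.card_erase_add_one (Finset.mem_univ a)
  rw [Finset.card_univ] at h2
  omega

theorem bernoulliExp_prod_one_sub_mul {I A B : Type*} [Fintype I] {p : ℝ}
    {φ : A → B → I} (hφ : Function.Injective2 φ) {c d : B}
    (hcd : c ≠ d) (s : Finset A) :
    bernoulliExp p (fun f => ∏ a ∈ s, (1 - coordVar (φ a c) f * coordVar (φ a d) f)) =
      (1 - p ^ 2) ^ s.card := by
  rw [bernoulliExp_prod (p := p) s
    (fun a f => 1 - coordVar (φ a c) f * coordVar (φ a d) f) (fun a => {φ a c, φ a d})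
    (fun a => dependsOn_one_sub_mul (by simp) (by simp)) (by
      intro a b hab
      simp [Function.onFun, hφ.eq_iff, hab.symm])]
  rw [Finset.prod_congr rfl fun a _ => bernoulliExp_one_sub_mul (p := p)
    (i := φ a c) (j := φ a d) (by simp [hφ.eq_iff, hcd])]
  simp

section Cross

variable {I A B : Type*} [Fintype I] [Fintype A] [Fintype B] {p : ℝ} {φ : A → B → I}

theorem bernoulliExp_noCommon_cross [DecidableEq A] [DecidableEq B] (hφ : Function.Injective2 φ)
    {a b : A} {c d : B} (hab : a ≠ b) (hcd : c ≠ d) :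
    bernoulliExp p (fun f => noCommon φ c d f * noCommon (flip φ) a b f) =
      ((1 - p) ^ 2 * (1 + 2 * p - p ^ 2)) *
        ((1 - p ^ 2) ^ ((Finset.univ.erase a).erase b).card *
          (1 - p ^ 2) ^ ((Finset.univ.erase c).erase d).card) := by
  have h : (fun f => noCommon φ c d f * noCommon (flip φ) a b f) = fun f =>
      (((1 - coordVar (φ a c) f * coordVar (φ a d) f) *
        (1 - coordVar (φ b d) f * coordVar (φ b c) f)) *
      ((1 - coordVar (φ a c) f * coordVar (φ b c) f) *
        (1 - coordVar (φ a d) f * coordVar (φ b d) f))) *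
      ((∏ x ∈ (Finset.univ.erase a).erase b, (1 - coordVar (φ x c) f * coordVar (φ x d) f)) *
        ∏ y ∈ (Finset.univ.erase c).erase d,
          (1 - coordVar (flip φ y a) f * coordVar (flip φ y b) f)) := by
    funext f
    rw [noCommon_eq_mul_prod_erase φ hab, noCommon_eq_mul_prod_erase (flip φ) hcd]
    simp only [flip]
    ring
  have hS : DependsOn (fun f : I → Bool => ∏ x ∈ (Finset.univ.erase a).erase b,
      (1 - coordVar (φ x c) f * coordVar (φ x d) f))
      {i | ∃ x y, x ≠ a ∧ x ≠ b ∧ (y = c ∨ y = d) ∧ i = φ x y} :=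
    DependsOn.finsetProd (S := fun x => {φ x c, φ x d})
      (fun x _ => dependsOn_one_sub_mul (by simp) (by simp)) (by
        intro x hx i hi
        simp only [Finset.mem_erase, Finset.mem_univ, and_true] at hx
        rcases hi with rfl | rfl
        · exact ⟨x, c, hx.2, hx.1, Or.inl rfl, rfl⟩
        · exact ⟨x, d, hx.2, hx.1, Or.inr rfl, rfl⟩)
  have hT : DependsOn (fun f : I → Bool => ∏ y ∈ (Finset.univ.erase c).erase d,
      (1 - coordVar (flip φ y a) f * coordVar (flip φ y b) f))
      {i | ∃ x y, y ≠ c ∧ y ≠ d ∧ (x = a ∨ x = b) ∧ i = φ x y} :=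
    DependsOn.finsetProd (S := fun y => {φ a y, φ b y})
      (fun y _ => dependsOn_one_sub_mul (by simp [flip]) (by simp [flip])) (by
        intro y hy i hi
        simp only [Finset.mem_erase, Finset.mem_univ, and_true] at hy
        rcases hi with rfl | rfl
        · exact ⟨a, y, hy.2, hy.1, Or.inl rfl, rfl⟩
        · exact ⟨b, y, hy.2, hy.1, Or.inr rfl, rfl⟩)
  have hC : DependsOn (fun f : I → Bool =>
      ((1 - coordVar (φ a c) f * coordVar (φ a d) f) *
        (1 - coordVar (φ b d) f * coordVar (φ b c) f)) *
      ((1 - coordVar (φ a c) f * coordVar (φ b c) f) *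
        (1 - coordVar (φ a d) f * coordVar (φ b d) f))) {φ a c, φ a d, φ b c, φ b d} :=
    DependsOn.mul'
      (DependsOn.mul' (dependsOn_one_sub_mul (by simp) (by simp))
        (dependsOn_one_sub_mul (by simp) (by simp)))
      (DependsOn.mul' (dependsOn_one_sub_mul (by simp) (by simp))
        (dependsOn_one_sub_mul (by simp) (by simp)))
  rw [h, bernoulliExp_mul_of_disjoint hC
      (DependsOn.mul' (S := {i | ∃ x y, (x ≠ a ∧ x ≠ b ∨ y ≠ c ∧ y ≠ d) ∧ i = φ x y})
        (fun _ _ h => hS fun i ⟨x, y, hxa, hxb, _, hi⟩ => h i ⟨x, y, Or.inl ⟨hxa, hxb⟩, hi⟩)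
        (fun _ _ h => hT fun i ⟨x, y, hyc, hyd, _, hi⟩ => h i ⟨x, y, Or.inr ⟨hyc, hyd⟩, hi⟩)) ?_,
    bernoulliExp_mul_of_disjoint hS hT ?_, bernoulliExp_fourCycle,
    bernoulliExp_prod_one_sub_mul hφ hcd, bernoulliExp_prod_one_sub_mul (injective2_flip hφ) hab]
  · simp [hφ.eq_iff, hcd]
  · simp [hφ.eq_iff, hab]
  · simp [hφ.eq_iff, hab]
  · simp [hφ.eq_iff, hab]
  · simp [hφ.eq_iff, hab]
  · simp [hφ.eq_iff, hcd.symm]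
  · rw [Set.disjoint_left]
    rintro i ⟨x, y, hxa, hxb, _, rfl⟩ ⟨x', y', _, _, hx', h'⟩
    have := (hφ h').1
    grind
  · rw [Set.disjoint_left]
    rintro i hi ⟨x, y, hxy, rfl⟩
    simp only [Set.mem_insert_iff, Set.mem_singleton_iff, hφ.eq_iff] at hi
    tauto

theorem cov_noCommon_cross_le [DecidableEq A] [DecidableEq B] (hφ : Function.Injective2 φ)
    (hp0 : 0 ≤ p) (hp1 : p < 1) {a b : A} {c d : B} (hab : a ≠ b) (hcd : c ≠ d) :
    bernoulliExp p (fun f => noCommon φ c d f * noCommon (flip φ) a b f) -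
        bernoulliExp p (noCommon φ c d) * bernoulliExp p (noCommon (flip φ) a b) ≤
      (1 - p ^ 2) ^ Fintype.card A * (1 - p ^ 2) ^ Fintype.card B *
        (4 * p ^ 3 / (1 - p) ^ 2) := by
  rw [bernoulliExp_noCommon_cross hφ hab hcd, bernoulliExp_noCommon hφ hcd,
    bernoulliExp_noCommon (injective2_flip hφ) hab, ← card_erase_erase_add_two hab,
    ← card_erase_erase_add_two hcd]
  have hq : 0 ≤ 1 - p ^ 2 := by nlinarith
  have hp : 1 - p ≠ 0 := by linarith
  have hu := pow_nonneg hq ((Finset.univ.erase a).erase b).card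
  have hv := pow_nonneg hq ((Finset.univ.erase c).erase d).card
  simp only [pow_add]
  set u := (1 - p ^ 2) ^ ((Finset.univ.erase a).erase b).card
  set v := (1 - p ^ 2) ^ ((Finset.univ.erase c).erase d).card
  have key : u * (1 - p ^ 2) ^ 2 * (v * (1 - p ^ 2) ^ 2) * (4 * p ^ 3 / (1 - p) ^ 2) -
      ((1 - p) ^ 2 * (1 + 2 * p - p ^ 2) * (u * v) -
        u * (1 - p ^ 2) ^ 2 * (v * (1 - p ^ 2) ^ 2)) =
      u * v * ((1 - p) ^ 2 * p ^ 3 * (4 * (1 + p) ^ 4 - (4 + p - 2 * p ^ 2 - p ^ 3))) := by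
    field_simp
    ring
  have hpos : 0 ≤ 4 * (1 + p) ^ 4 - (4 + p - 2 * p ^ 2 - p ^ 3) := by
    have : 4 * (1 + p) ^ 4 - (4 + p - 2 * p ^ 2 - p ^ 3) =
        15 * p + 26 * p ^ 2 + 17 * p ^ 3 + 4 * p ^ 4 := by ring
    rw [this]
    positivity
  have : 0 ≤ u * v * ((1 - p) ^ 2 * p ^ 3 * (4 * (1 + p) ^ 4 - (4 + p - 2 * p ^ 2 - p ^ 3))) := by
    positivity
  linarith

theorem cov_noCommonCount_cross_le [DecidableEq A] [DecidableEq B] (hφ : Function.Injective2 φ)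
    (hp0 : 0 ≤ p) (hp1 : p < 1) :
    bernoulliExp p (fun f => noCommonCount φ f * noCommonCount (flip φ) f) -
        bernoulliExp p (noCommonCount φ) * bernoulliExp p (noCommonCount (flip φ)) ≤
      Fintype.card B * ((Fintype.card B : ℝ) - 1) *
        (Fintype.card A * ((Fintype.card A : ℝ) - 1) *
        ((1 - p ^ 2) ^ Fintype.card A * (1 - p ^ 2) ^ Fintype.card B *
          (4 * p ^ 3 / (1 - p) ^ 2))) := by
  refine (cov_sum _ _ _ _).trans_le ?_
  rw [← card_offDiag_univ, ← card_offDiag_univ, ← nsmul_eq_mul, ← nsmul_eq_mul]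
  refine Finset.sum_le_card_nsmul _ _ _ fun x hx => Finset.sum_le_card_nsmul _ _ _ fun y hy => ?_
  exact cov_noCommon_cross_le hφ hp0 hp1 (Finset.mem_offDiag.1 hy).2.2 (Finset.mem_offDiag.1 hx).2.2

end Cross

theorem second_moment_bound {I : Type*} [Fintype I] {p : ℝ} (hp0 : 0 ≤ p) (hp1 : p ≤ 1)
    (N : (I → Bool) → ℝ) :
    bernoulliExp p (fun f => if N f = 0 then 1 else 0) * bernoulliExp p N ^ 2 ≤
      bernoulliExp p (fun f => N f * N f) - bernoulliExp p N * bernoulliExp p N := by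
  set m := bernoulliExp p N with hm
  have h1 : bernoulliExp p (fun f => m ^ 2 * (if N f = 0 then 1 else 0)) ≤
      bernoulliExp p (fun f => N f * N f - 2 * m * N f + m ^ 2) := by
    refine bernoulliExp_mono hp0 hp1 fun f => ?_
    split_ifs with h
    · simp [h]
    · nlinarith [sq_nonneg (N f - m)]
  rw [bernoulliExp_const_mul, bernoulliExp_add, bernoulliExp_sub, bernoulliExp_const_mul,
    bernoulliExp_const, ← hm] at h1
  linarith

theorem noCommonCount_eq_zero {I A B : Type*} [Fintype A] [Fintype B] [DecidableEq B]
    {φ : A → B → I} {f : I → Bool} (h : ∀ c d, c ≠ d → ∃ a, f (φ a c) ∧ f (φ a d)) :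
    noCommonCount φ f = 0 := by
  refine Finset.sum_eq_zero fun x hx => ?_
  obtain ⟨a, ha, hb⟩ := h x.1 x.2 (Finset.mem_offDiag.1 hx).2.2
  exact Finset.prod_eq_zero (Finset.mem_univ a) (by simp [coordVar, ha, hb])

section Graph

variable {n₁ n₂ : ℕ}

/-- The edge indicator of a graph on `Fin n₁ ⊕ Fin n₂`, restricted to edges between the two
partite sets. -/
noncomputable def edgeIndicator (G : SimpleGraph (Fin n₁ ⊕ Fin n₂)) (e : Fin n₁ × Fin n₂) : Bool :=
  decide (G.Adj (Sum.inl e.1) (Sum.inr e.2))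

theorem adj_eq_of_edgeIndicator_eq {G H : SimpleGraph (Fin n₁ ⊕ Fin n₂)}
    (hG : ∀ u v, G.Adj u v → u.isLeft ≠ v.isLeft) (hH : ∀ u v, H.Adj u v → u.isLeft ≠ v.isLeft)
    (h : edgeIndicator G = edgeIndicator H) : G = H := by
  have key (a : Fin n₁) (b : Fin n₂) :
      G.Adj (Sum.inl a) (Sum.inr b) ↔ H.Adj (Sum.inl a) (Sum.inr b) := by
    simpa [edgeIndicator] using congrFun h (a, b)
  ext u v
  rcases u with a | a <;> rcases v with b | b
  · exact ⟨fun h => (hG _ _ h rfl).elim, fun h => (hH _ _ h rfl).elim⟩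
  · exact key a b
  · rw [G.adj_comm, H.adj_comm]
    exact key b a
  · exact ⟨fun h => (hG _ _ h rfl).elim, fun h => (hH _ _ h rfl).elim⟩

theorem card_edgeSet_eq_card_edgeIndicator {G : SimpleGraph (Fin n₁ ⊕ Fin n₂)}
    (hG : ∀ u v, G.Adj u v → u.isLeft ≠ v.isLeft) :
    Nat.card G.edgeSet = (Finset.univ.filter fun e => edgeIndicator G e = true).card := by
  rw [← Fintype.card_subtype, ← Nat.card_eq_fintype_card]
  symm
  refine Nat.card_congr (Equiv.ofBijective
    (fun e => ⟨s(Sum.inl e.1.1, Sum.inr e.1.2), by simpa [edgeIndicator] using e.2⟩) ⟨?_, ?_⟩)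
  · rintro ⟨⟨a, b⟩, _⟩ ⟨⟨a', b'⟩, _⟩ h
    simpa using h
  · rintro ⟨e, he⟩
    induction e using Sym2.ind with | _ u v => ?_
    rw [SimpleGraph.mem_edgeSet] at he
    rcases u with a | a <;> rcases v with b | b
    · exact (hG _ _ he rfl).elim
    · exact ⟨⟨(a, b), by simpa [edgeIndicator] using he⟩, rfl⟩
    · exact ⟨⟨(b, a), by simpa [edgeIndicator] using he.symm⟩, Subtype.ext Sym2.eq_swap⟩
    · exact (hG _ _ he rfl).elim

theorem graph_weight_eq {G : SimpleGraph (Fin n₁ ⊕ Fin n₂)}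
    (hG : ∀ u v, G.Adj u v → u.isLeft ≠ v.isLeft) (p : ℝ) :
    p ^ Nat.card G.edgeSet * (1 - p) ^ (n₁ * n₂ - Nat.card G.edgeSet) =
      ∏ e, if edgeIndicator G e then p else 1 - p := by
  rw [Finset.prod_ite, Finset.prod_const, Finset.prod_const,
    card_edgeSet_eq_card_edgeIndicator hG]
  congr 2
  have h := Finset.card_filter_add_card_filter_not (s := Finset.univ)
    (fun e : Fin n₁ × Fin n₂ => edgeIndicator G e = true)
  rw [Finset.card_univ, Fintype.card_prod, Fintype.card_fin, Fintype.card_fin] at h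
  omega

theorem exists_common_adj {G : SimpleGraph (Fin n₁ ⊕ Fin n₂)}
    (hG : ∀ u v, G.Adj u v → u.isLeft ≠ v.isLeft) (hc : G.Connected) {u v : Fin n₁ ⊕ Fin n₂}
    (hd : G.dist u v ≤ 3) (huv : u ≠ v) (hs : u.isLeft = v.isLeft) :
    ∃ w, G.Adj u w ∧ G.Adj w v := by
  obtain ⟨W, hW⟩ := hc.exists_walk_length_eq_dist u v
  rw [← hW] at hd
  match W, hd with
  | .nil, _ => exact absurd rfl huv
  | .cons h .nil, _ => exact absurd hs (hG _ _ h)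
  | .cons h (.cons h' .nil), _ => exact ⟨_, h, h'⟩
  | .cons h (.cons h' (.cons h'' .nil)), _ =>
    have e1 := hG _ _ h
    have e2 := hG _ _ h'
    have e3 := hG _ _ h''
    grind
  | .cons h (.cons h' (.cons h'' (.cons _ _))), hd =>
    simp only [SimpleGraph.Walk.length_cons] at hd
    omega

theorem bipartiteDiam3Prob_le_bernoulliExp {p : ℝ} (hp0 : 0 ≤ p) (hp1 : p ≤ 1) :
    bipartiteDiam3Prob n₁ n₂ p ≤ bernoulliExp p (fun f : Fin n₁ × Fin n₂ → Bool =>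
      if noCommonCount Prod.mk f + noCommonCount (flip Prod.mk) f = 0 then 1 else 0) := by
  rw [bipartiteDiam3Prob, ← Finset.sum_filter]
  simp only [bernoulliExp, mul_ite, mul_one, mul_zero]
  rw [← Finset.sum_filter]
  rw [Finset.sum_congr rfl fun G hG => graph_weight_eq (Finset.mem_filter.1 hG).2.1 p]
  rw [← Finset.sum_image (g := edgeIndicator)
    (f := fun f : Fin n₁ × Fin n₂ → Bool => ∏ e, if f e then p else 1 - p) (by
      intro G hG H hH h
      exact adj_eq_of_edgeIndicator_eq (Finset.mem_filter.1 hG).2.1 (Finset.mem_filter.1 hH).2.1 h)]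
  refine Finset.sum_le_sum_of_subset_of_nonneg ?_ fun f _ _ => bernoulli_weight_nonneg hp0 hp1 f
  intro f hf
  obtain ⟨G, hG, rfl⟩ := Finset.mem_image.1 hf
  obtain ⟨hG, hc, hd⟩ := (Finset.mem_filter.1 hG).2
  refine Finset.mem_filter.2 ⟨@Finset.mem_univ _ (_) _, ?_⟩
  rw [noCommonCount_eq_zero, noCommonCount_eq_zero, add_zero]
  · intro a b hab
    obtain ⟨w, h1, h2⟩ := exists_common_adj hG hc (hd (Sum.inl a) (Sum.inl b)) (by simpa) rfl
    rcases w with w | w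
    · exact (hG _ _ h1 rfl).elim
    · exact ⟨w, decide_eq_true h1,
        decide_eq_true h2.symm⟩
  · intro c d hcd
    obtain ⟨w, h1, h2⟩ := exists_common_adj hG hc (hd (Sum.inr c) (Sum.inr d)) (by simpa) rfl
    rcases w with w | w
    · exact ⟨w, decide_eq_true h1.symm, decide_eq_true h2⟩
    · exact (hG _ _ h1 rfl).elim

end Graph

theorem cherry_pow_le {p : ℝ} (hp0 : 0 ≤ p) (hp1 : p < 1) {k n : ℕ} (hkn : k ≤ n) :
    (1 - 2 * p ^ 2 + p ^ 3) ^ n ≤ ((1 - p ^ 2) ^ k) ^ 2 * (1 + p ^ 3 / (1 - p)) ^ k := by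
  have hp : 0 < 1 - p := by linarith
  have ht : 0 ≤ 1 - 2 * p ^ 2 + p ^ 3 := by
    have : 1 - 2 * p ^ 2 + p ^ 3 = (1 - p) * (1 + p * (1 - p)) := by ring
    rw [this]
    positivity
  have ht1 : 1 - 2 * p ^ 2 + p ^ 3 ≤ 1 := by nlinarith [sq_nonneg p]
  refine (pow_le_pow_of_le_one ht ht1 hkn).trans ?_
  rw [← pow_mul, mul_comm k 2, pow_mul, ← mul_pow]
  refine pow_le_pow_left₀ ht ?_ k
  have : (1 - p ^ 2) ^ 2 * (1 + p ^ 3 / (1 - p)) - (1 - 2 * p ^ 2 + p ^ 3) =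
      (1 - p) * p ^ 4 * (2 + p) := by
    field_simp
    ring
  have : 0 ≤ (1 - p) * p ^ 4 * (2 + p) := by positivity
  linarith

theorem variance_budget {p : ℝ} (hp0 : 0 ≤ p) (hp1 : p < 1) {n₁ n₂ : ℕ} (h1 : 2 ≤ n₁)
    (h12 : n₁ ≤ n₂) {Q₁ Q₂ T₁ T₂ R : ℝ} (hQ₁ : 0 ≤ Q₁) (hQ₂ : 0 ≤ Q₂) (hQ : Q₂ ≤ Q₁)
    (hT₁ : T₁ ≤ Q₁ ^ 2 * R) (hT₂ : T₂ ≤ Q₁ ^ 2 * R) (hR : 1 + n₁ * (p ^ 3 / (1 - p)) ≤ R) :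
    (n₂ * ((n₂ : ℝ) - 1) * (2 * Q₁ + 4 * ((n₂ : ℝ) - 1) * T₁)) +
      (n₁ * ((n₁ : ℝ) - 1) * (2 * Q₂ + 4 * ((n₁ : ℝ) - 1) * T₂)) +
      2 * (n₂ * ((n₂ : ℝ) - 1) * (n₁ * ((n₁ : ℝ) - 1) * (Q₁ * Q₂ * (4 * p ^ 3 / (1 - p) ^ 2)))) ≤
    2 * (n₂ * ((n₂ : ℝ) - 1) * Q₁ + n₁ * ((n₁ : ℝ) - 1) * Q₂) +
      R * (8 + 8 / (1 - p)) * (((n₂ : ℝ) - 1) * Q₁) *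
        (n₂ * ((n₂ : ℝ) - 1) * Q₁ + n₁ * ((n₁ : ℝ) - 1) * Q₂) := by
  have hx : (2 : ℝ) ≤ n₁ := by exact_mod_cast h1
  have hxy : (n₁ : ℝ) ≤ n₂ := by exact_mod_cast h12
  generalize (n₁ : ℝ) = x at *
  generalize (n₂ : ℝ) = y at *
  have hp : 0 < 1 - p := by linarith
  have hs : 0 ≤ p ^ 3 / (1 - p) := by positivity
  have hx1 : 0 ≤ x - 1 := by linarith
  have hy1 : 0 ≤ y - 1 := by linarith
  have hx0 : 0 ≤ x := by linarith
  have hy0 : 0 ≤ y := by linarith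
  have hR0 : 0 ≤ R := le_trans (by positivity) hR
  set W := y * (y - 1) ^ 2 * Q₁ ^ 2 with hW
  have hW0 : 0 ≤ W := by positivity
  have b1 : y * (y - 1) * (4 * (y - 1) * T₁) ≤ 4 * (W * R) := by
    calc y * (y - 1) * (4 * (y - 1) * T₁) ≤ y * (y - 1) * (4 * (y - 1) * (Q₁ ^ 2 * R)) := by gcongr
      _ = _ := by rw [hW]; ring
  have b2 : x * (x - 1) * (4 * (x - 1) * T₂) ≤ 4 * (W * R) := by
    calc x * (x - 1) * (4 * (x - 1) * T₂) ≤ x * (x - 1) * (4 * (x - 1) * (Q₁ ^ 2 * R)) := by gcongr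
      _ ≤ y * (y - 1) * (4 * (y - 1) * (Q₁ ^ 2 * R)) := by gcongr
      _ = _ := by rw [hW]; ring
  have b3 : 2 * (y * (y - 1) * (x * (x - 1) * (Q₁ * Q₂ * (4 * p ^ 3 / (1 - p) ^ 2)))) ≤
      8 / (1 - p) * (W * R) := by
    calc 2 * (y * (y - 1) * (x * (x - 1) * (Q₁ * Q₂ * (4 * p ^ 3 / (1 - p) ^ 2))))
        ≤ 2 * (y * (y - 1) * (x * (y - 1) * (Q₁ * Q₁ * (4 * p ^ 3 / (1 - p) ^ 2)))) := by gcongr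
      _ = 8 / (1 - p) * (W * (x * (p ^ 3 / (1 - p)))) := by
        rw [hW]
        field_simp
        ring
      _ ≤ 8 / (1 - p) * (W * R) := by
        gcongr
        linarith
  have b4 : 0 ≤ R * (8 + 8 / (1 - p)) * ((y - 1) * Q₁) * (x * (x - 1) * Q₂) := by positivity
  have e : R * (8 + 8 / (1 - p)) * ((y - 1) * Q₁) * (y * (y - 1) * Q₁ + x * (x - 1) * Q₂) =
      8 * (W * R) + 8 / (1 - p) * (W * R) +
        R * (8 + 8 / (1 - p)) * ((y - 1) * Q₁) * (x * (x - 1) * Q₂) := by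
    rw [hW]
    ring
  linarith

/-- Turán-sieve upper bound for random bipartite graphs having diameter at most 3. -/
theorem bipartiteDiam3Prob_upper (n₁ n₂ n : ℕ) (h1 : 2 ≤ n₁) (h12 : n₁ ≤ n₂)
    (hn : n₁ + n₂ = n) (hn4 : 4 ≤ n) (p : ℝ) (hp0 : 0 < p) (hp1 : p < 1) :
    bipartiteDiam3Prob n₁ n₂ p ≤
      (2 / ((n₂ : ℝ) * ((n₂ : ℝ) - 1) * (1 - p ^ 2) ^ n₁) +
          ((1 + p ^ 3 / (1 - p)) ^ n₁ / (n₂ : ℝ)) * (8 + 8 / (1 - p))) *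
        (1 + (n₁ : ℝ) * ((n₁ : ℝ) - 1) * (1 - p ^ 2) ^ (n₂ - n₁) /
            ((n₂ : ℝ) * ((n₂ : ℝ) - 1)))⁻¹ := by
  set N : (Fin n₁ × Fin n₂ → Bool) → ℝ :=
    fun f => noCommonCount Prod.mk f + noCommonCount (flip Prod.mk) f with hN
  have hφ : Function.Injective2 (Prod.mk : Fin n₁ → Fin n₂ → Fin n₁ × Fin n₂) :=
    fun _ _ _ _ h => Prod.mk.inj h
  have hx : (2 : ℝ) ≤ n₁ := by exact_mod_cast h1
  have hxy : (n₁ : ℝ) ≤ n₂ := by exact_mod_cast h12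
  have hp : 0 < 1 - p := by linarith
  have hq : 0 < 1 - p ^ 2 := by nlinarith
  have hx1 : 0 < (n₁ : ℝ) - 1 := by linarith
  have hy1 : 0 < (n₂ : ℝ) - 1 := by linarith
  have hx0 : 0 < (n₁ : ℝ) := by linarith
  have hy0 : 0 < (n₂ : ℝ) := by linarith
  have hmean : bernoulliExp p N = n₂ * ((n₂ : ℝ) - 1) * (1 - p ^ 2) ^ n₁ +
      n₁ * ((n₁ : ℝ) - 1) * (1 - p ^ 2) ^ n₂ := by
    rw [hN, bernoulliExp_add, bernoulliExp_noCommonCount hφ,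
      bernoulliExp_noCommonCount (injective2_flip hφ)]
    simp only [Fintype.card_fin]
  have hvar : bernoulliExp p (fun f => N f * N f) - bernoulliExp p N * bernoulliExp p N ≤
      2 * bernoulliExp p N + (1 + p ^ 3 / (1 - p)) ^ n₁ * (8 + 8 / (1 - p)) *
        (((n₂ : ℝ) - 1) * (1 - p ^ 2) ^ n₁) * bernoulliExp p N := by
    have v1 := variance_noCommonCount_le (p := p) hφ hp0.le hp1.le
    have v2 := variance_noCommonCount_le (p := p) (injective2_flip hφ) hp0.le hp1.le
    have v3 := cov_noCommonCount_cross_le (p := p) hφ hp0.le hp1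
    have hsq : bernoulliExp p (fun f => N f * N f) =
        bernoulliExp p (fun f : Fin n₁ × Fin n₂ → Bool =>
          noCommonCount Prod.mk f * noCommonCount Prod.mk f) +
        bernoulliExp p (fun f : Fin n₁ × Fin n₂ → Bool =>
          noCommonCount (flip Prod.mk) f * noCommonCount (flip Prod.mk) f) +
        2 * bernoulliExp p (fun f : Fin n₁ × Fin n₂ → Bool =>
          noCommonCount Prod.mk f * noCommonCount (flip Prod.mk) f) := by
      rw [← bernoulliExp_add, ← bernoulliExp_const_mul, ← bernoulliExp_add]
      congr 1
      funext f
      simp only [hN]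
      ring
    have hadd : bernoulliExp p N = bernoulliExp p (noCommonCount Prod.mk) +
        bernoulliExp p (noCommonCount (flip Prod.mk)) := bernoulliExp_add _ _
    have hbudget := variance_budget hp0.le hp1 h1 h12 (Q₁ := (1 - p ^ 2) ^ n₁)
      (Q₂ := (1 - p ^ 2) ^ n₂) (by positivity) (by positivity)
      (pow_le_pow_of_le_one hq.le (by nlinarith) h12)
      (cherry_pow_le hp0.le hp1 le_rfl) (cherry_pow_le hp0.le hp1 h12)
      (one_add_mul_le_pow (by have : 0 ≤ p ^ 3 / (1 - p) := by positivity
                              linarith) n₁)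
    rw [← hmean] at hbudget
    simp only [Fintype.card_fin] at v1 v2 v3
    refine le_trans ?_ hbudget
    rw [hsq, hadd]
    linarith
  have hcheb := (second_moment_bound hp0.le hp1.le N).trans hvar
  refine (bipartiteDiam3Prob_le_bernoulliExp hp0.le hp1.le).trans ?_
  have hmpos : 0 < bernoulliExp p N := by
    rw [hmean]
    positivity
  have hrhs : (2 / ((n₂ : ℝ) * ((n₂ : ℝ) - 1) * (1 - p ^ 2) ^ n₁) +
      ((1 + p ^ 3 / (1 - p)) ^ n₁ / (n₂ : ℝ)) * (8 + 8 / (1 - p))) *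
        (1 + (n₁ : ℝ) * ((n₁ : ℝ) - 1) * (1 - p ^ 2) ^ (n₂ - n₁) /
          ((n₂ : ℝ) * ((n₂ : ℝ) - 1)))⁻¹ =
      (2 + (1 + p ^ 3 / (1 - p)) ^ n₁ * (8 + 8 / (1 - p)) *
        (((n₂ : ℝ) - 1) * (1 - p ^ 2) ^ n₁)) / bernoulliExp p N := by
    have hden : bernoulliExp p N = (n₂ * ((n₂ : ℝ) - 1) * (1 - p ^ 2) ^ n₁) *
        (1 + (n₁ : ℝ) * ((n₁ : ℝ) - 1) * (1 - p ^ 2) ^ (n₂ - n₁) /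
          ((n₂ : ℝ) * ((n₂ : ℝ) - 1))) := by
      rw [hmean, ← pow_mul_pow_sub (1 - p ^ 2) h12]
      field_simp
    have hD : 0 < 1 + (n₁ : ℝ) * ((n₁ : ℝ) - 1) * (1 - p ^ 2) ^ (n₂ - n₁) /
        ((n₂ : ℝ) * ((n₂ : ℝ) - 1)) := by positivity
    rw [hden]
    generalize 1 + (n₁ : ℝ) * ((n₁ : ℝ) - 1) * (1 - p ^ 2) ^ (n₂ - n₁) /
      ((n₂ : ℝ) * ((n₂ : ℝ) - 1)) = D at hD
    generalize (1 + p ^ 3 / (1 - p)) ^ n₁ = R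
    generalize 8 + 8 / (1 - p) = C
    field_simp
  rw [hrhs, le_div_iff₀ hmpos]
  refine le_of_mul_le_mul_right ?_ hmpos
  linarith
end
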